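/- arXiv:0906.0451 — 3 statements merged into one kernel-verified Lean document; each statement's English description precedes it below -/
import Mathlib

section
/- Let ν₃ < 0 < ν₁ < ν₀ be real numbers. Let W be a continuous real-valued function on the closed rectangle [ν₁,ν₀] × [0,ν₁], and on the open rectangle (ν₁,ν₀) × (0,ν₁) define K̃₁(x₁,x₂) = W(x₁,x₂) / (√(x₁−ν₁)·√(ν₀−x₁)·√(x₂)·√(ν₁−x₂)), which is integrable on the rectangle. Assume: (A) for every κ₁ < 0 and every κ₂ ∈ (0,ν₁), the absolutely convergent integral ∫_{ν₁}^{ν₀} ∫_0^{κ₂} K̃₁(x₁,x₂) / ( √((x₁−κ₁)(x₂−κ₁)) · √((x₁−κ₂)(κ₂−x₂)) ) dx₂ dx₁ equals 0; and (B) for every κ₁ < 0 and every κ₂ ∈ (ν₁,ν₀), the absolutely convergent integral ∫_0^{ν₁} ∫_{κ₂}^{ν₀} K̃₁(x₁,x₂) / ( √((x₁−κ₁)(x₂−κ₁)) · √((x₁−κ₂)(κ₂−x₂)) ) dx₁ dx₂ equals 0. Then W is identically zero on [ν₁,ν₀] × [0,ν₁]. -/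
open MeasureTheory Set

/-- Chebyshev weight on `(y, x)`: total mass. -/
lemma kernel_mass {x y : ℝ} (h : y < x) :
    IntegrableOn (fun k : ℝ => 1 / Real.sqrt ((x - k) * (k - y))) (Ioc y x) ∧
    ∫ k in y..x, 1 / Real.sqrt ((x - k) * (k - y)) = Real.pi := by
  have hd : 0 < x - y := by linarith
  have hcont : ContinuousOn (fun k : ℝ => Real.arcsin ((2 * k - x - y) / (x - y))) (Icc y x) := by
    apply Continuous.continuousOn
    exact Real.continuous_arcsin.comp (by fun_prop)
  have hder : ∀ k ∈ Ioo y x, HasDerivAt (fun k : ℝ => Real.arcsin ((2 * k - x - y) / (x - y)))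
      (1 / Real.sqrt ((x - k) * (k - y))) k := by
    intro k hk
    have h1 : 0 < x - k := by linarith [hk.2]
    have h2 : 0 < k - y := by linarith [hk.1]
    have hz : HasDerivAt (fun k : ℝ => (2 * k - x - y) / (x - y)) (2 / (x - y)) k := by
      have := ((((hasDerivAt_id k).const_mul 2).sub_const x).sub_const y).div_const (x - y)
      simpa using this
    have hm1 : (2 * k - x - y) / (x - y) ≠ -1 := by
      rw [Ne, div_eq_iff hd.ne']; intro hh; linarith
    have hp1 : (2 * k - x - y) / (x - y) ≠ 1 := by
      rw [Ne, div_eq_iff hd.ne']; intro hh; linarith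
    have := (Real.hasDerivAt_arcsin hm1 hp1).comp k hz
    refine this.congr_deriv ?_
    have e : 1 - ((2 * k - x - y) / (x - y)) ^ 2 =
        (2 / (x - y)) ^ 2 * ((x - k) * (k - y)) := by
      field_simp; ring
    rw [e, Real.sqrt_mul (by positivity), Real.sqrt_sq (by positivity)]
    have : 0 < Real.sqrt ((x - k) * (k - y)) := Real.sqrt_pos.2 (by positivity)
    field_simp
  have hint := intervalIntegral.integrableOn_deriv_of_nonneg hcont hder
    (fun k _ => by positivity)
  refine ⟨hint, ?_⟩
  rw [intervalIntegral.integral_eq_sub_of_hasDerivAt_of_le h.le hcont hder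
    ((intervalIntegrable_iff_integrableOn_Ioc_of_le h.le).2 hint)]
  have e1 : (2 * x - x - y) / (x - y) = 1 := by field_simp; ring
  have e2 : (2 * y - x - y) / (x - y) = -1 := by field_simp; ring
  simp only [e1, e2, Real.arcsin_one, Real.arcsin_neg]; ring

lemma kernel_cauchy {x y c : ℝ} (h : y < x) (hy : 0 < y + c) :
    ∫ k in y..x, 1 / ((k + c) * Real.sqrt ((x - k) * (k - y))) =
      Real.pi / Real.sqrt ((x + c) * (y + c)) := by
  have hd : 0 < x - y := by linarith
  have hx : 0 < x + c := by linarith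
  have hs : 0 < Real.sqrt ((x + c) * (y + c)) := Real.sqrt_pos.2 (by positivity)
  set z : ℝ → ℝ := fun k => ((x - y) ^ 2 + (x + y + 2 * c) * (2 * k - x - y)) /
    (2 * (x - y) * (k + c)) with hzdef
  have hcont : ContinuousOn (fun k : ℝ => Real.arcsin (z k) / Real.sqrt ((x + c) * (y + c)))
      (Icc y x) := by
    apply ContinuousOn.div_const
    apply Real.continuous_arcsin.comp_continuousOn
    apply ContinuousOn.div (by fun_prop) (by fun_prop)
    intro k hk
    have : 0 < k + c := by linarith [hk.1]
    positivity
  have hder : ∀ k ∈ Ioo y x,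
      HasDerivAt (fun k : ℝ => Real.arcsin (z k) / Real.sqrt ((x + c) * (y + c)))
      (1 / ((k + c) * Real.sqrt ((x - k) * (k - y)))) k := by
    intro k hk
    have h1 : 0 < x - k := by linarith [hk.2]
    have h2 : 0 < k - y := by linarith [hk.1]
    have h3 : 0 < k + c := by linarith [hk.1]
    have hz : HasDerivAt z (2 * (x + c) * (y + c) / ((x - y) * (k + c) ^ 2)) k := by
      have hn : HasDerivAt (fun k : ℝ => (x - y) ^ 2 + (x + y + 2 * c) * (2 * k - x - y))
          ((x + y + 2 * c) * 2) k := by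
        have := ((((((hasDerivAt_id k).const_mul 2).sub_const x).sub_const y)).const_mul
          (x + y + 2 * c)).const_add ((x - y) ^ 2)
        simpa using this
      have hdn : HasDerivAt (fun k : ℝ => 2 * (x - y) * (k + c)) (2 * (x - y)) k := by
        have := ((hasDerivAt_id k).add_const c).const_mul (2 * (x - y))
        simpa using this
      refine (hn.div hdn (by positivity)).congr_deriv ?_
      field_simp; ring
    have e : 1 - (z k) ^ 2 =
        (2 / ((x - y) * (k + c))) ^ 2 * (((x + c) * (y + c)) * ((x - k) * (k - y))) := by
      simp only [hzdef]; field_simp; ring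
    have hpos : 0 < 1 - (z k) ^ 2 := by rw [e]; positivity
    have hm1 : z k ≠ -1 := by intro hh; rw [hh] at hpos; norm_num at hpos
    have hp1 : z k ≠ 1 := by intro hh; rw [hh] at hpos; norm_num at hpos
    have := ((Real.hasDerivAt_arcsin hm1 hp1).comp k hz).div_const
      (Real.sqrt ((x + c) * (y + c)))
    refine this.congr_deriv ?_
    rw [e, Real.sqrt_mul (by positivity), Real.sqrt_sq (by positivity),
      Real.sqrt_mul (by positivity : 0 ≤ (x + c) * (y + c))]
    have h4 : 0 < Real.sqrt ((x - k) * (k - y)) := Real.sqrt_pos.2 (by positivity)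
    have h5 : Real.sqrt ((x + c) * (y + c)) ^ 2 = (x + c) * (y + c) :=
      Real.sq_sqrt (by positivity)
    field_simp
    rw [h5]
  have hint := intervalIntegral.integrableOn_deriv_of_nonneg hcont hder
    (fun k hk => by
      have h3 : 0 < k + c := by linarith [hk.1]
      positivity)
  rw [intervalIntegral.integral_eq_sub_of_hasDerivAt_of_le h.le hcont hder
    ((intervalIntegrable_iff_integrableOn_Ioc_of_le h.le).2 hint)]
  have e1 : z x = 1 := by simp only [hzdef]; field_simp; ring
  have e2 : z y = -1 := by simp only [hzdef]; field_simp; ring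
  simp only [e1, e2, Real.arcsin_one, Real.arcsin_neg]; ring

lemma kernel_intervalIntegrable {x y : ℝ} (h : y < x) (f : ℝ → ℝ) (hf : ContinuousOn f (Icc y x)) :
    IntervalIntegrable (fun k : ℝ => f k * (1 / Real.sqrt ((x - k) * (k - y)))) volume y x := by
  have h0 := (intervalIntegrable_iff_integrableOn_Ioc_of_le h.le).2 (kernel_mass h).1
  exact h0.continuousOn_mul (by rwa [uIcc_of_le h.le])

/-- Generalised Legendre polynomials. -/
noncomputable def legP {A : Type*} [CommRing A] [Algebra ℝ A] (s p : A) : ℕ → A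
  | 0 => 1
  | 1 => s
  | n + 2 => (1 / ((n : ℝ) + 2)) • ((2 * (n : ℝ) + 3) • (s * legP s p (n + 1)) -
      ((n : ℝ) + 1) • (p * legP s p n))

lemma legP_rec {A : Type*} [CommRing A] [Algebra ℝ A] (s p : A) (n : ℕ) :
    ((n : ℝ) + 2) • legP s p (n + 2) = (2 * (n : ℝ) + 3) • (s * legP s p (n + 1)) -
      ((n : ℝ) + 1) • (p * legP s p n) := by
  rw [legP, smul_smul, mul_one_div_cancel (by positivity), one_smul]

lemma kernel_rec {x y : ℝ} (h : y < x) (n : ℕ) :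
    ((n : ℝ) + 1) * ∫ k in y..x, k ^ (n + 1) * (1 / Real.sqrt ((x - k) * (k - y))) =
    (2 * (n : ℝ) + 1) * ((x + y) / 2) * (∫ k in y..x, k ^ n * (1 / Real.sqrt ((x - k) * (k - y))))
     - n * (x * y) * ∫ k in y..x, k ^ (n - 1) * (1 / Real.sqrt ((x - k) * (k - y))) := by
  have hcont : ContinuousOn (fun k : ℝ => k ^ n * Real.sqrt ((x - k) * (k - y))) (Icc y x) := by
    fun_prop
  have hI : ∀ m : ℕ, IntervalIntegrable
      (fun k : ℝ => k ^ m * (1 / Real.sqrt ((x - k) * (k - y)))) volume y x :=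
    fun m => kernel_intervalIntegrable h _ (by fun_prop)
  have hder : ∀ k ∈ Ioo y x, HasDerivAt (fun k : ℝ => k ^ n * Real.sqrt ((x - k) * (k - y)))
      ((2 * (n : ℝ) + 1) * ((x + y) / 2) * (k ^ n * (1 / Real.sqrt ((x - k) * (k - y))))
       - n * (x * y) * (k ^ (n - 1) * (1 / Real.sqrt ((x - k) * (k - y))))
       - ((n : ℝ) + 1) * (k ^ (n + 1) * (1 / Real.sqrt ((x - k) * (k - y))))) k := by
    intro k hk
    have h1 : 0 < x - k := by linarith [hk.2]
    have h2 : 0 < k - y := by linarith [hk.1]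
    have hr : HasDerivAt (fun k : ℝ => (x - k) * (k - y)) (x + y - 2 * k) k := by
      have := ((hasDerivAt_id k).const_sub x).mul ((hasDerivAt_id k).sub_const y)
      refine this.congr_deriv ?_
      simp; ring
    have := (hasDerivAt_pow n k).mul (hr.sqrt (by positivity))
    refine this.congr_deriv ?_
    have h4 : 0 < Real.sqrt ((x - k) * (k - y)) := Real.sqrt_pos.2 (by positivity)
    have h5 : Real.sqrt ((x - k) * (k - y)) ^ 2 = (x - k) * (k - y) :=
      Real.sq_sqrt (by positivity)
    field_simp
    rw [h5]
    rcases n with _ | n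
    · simp; ring
    · simp only [Nat.add_sub_cancel]; push_cast; ring
  have hint := ((((hI n).const_mul ((2 * (n : ℝ) + 1) * ((x + y) / 2))).sub
    ((hI (n - 1)).const_mul (n * (x * y)))).sub ((hI (n + 1)).const_mul ((n : ℝ) + 1)))
  have key := intervalIntegral.integral_eq_sub_of_hasDerivAt_of_le h.le hcont hder hint
  rw [intervalIntegral.integral_sub (((hI n).const_mul _).sub ((hI (n - 1)).const_mul _))
      ((hI (n + 1)).const_mul _),
    intervalIntegral.integral_sub ((hI n).const_mul _) ((hI (n - 1)).const_mul _)] at key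
  simp only [intervalIntegral.integral_const_mul] at key
  simp at key
  simp
  linarith

lemma kernel_moment {x y : ℝ} (h : y < x) (n : ℕ) :
    ∫ k in y..x, k ^ n * (1 / Real.sqrt ((x - k) * (k - y))) =
      Real.pi * legP ((x + y) / 2) (x * y) n := by
  induction n using Nat.strong_induction_on with
  | _ n ih =>
    rcases n with _ | _ | n
    · simpa [legP] using (kernel_mass h).2
    · have := kernel_rec h 0
      have h0 := (kernel_mass h).2
      simp [legP] at this h0 ⊢
      rw [this, h0]; ring
    · have := kernel_rec h (n + 1)
      rw [Nat.add_sub_cancel, ih n (by omega), ih (n + 1) (by omega)] at this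
      have r := legP_rec ((x + y) / 2) (x * y) n
      simp only [smul_eq_mul] at r
      have hn : ((n : ℝ) + 2) ≠ 0 := by positivity
      apply mul_left_cancel₀ hn
      push_cast at this
      linear_combination this - Real.pi * r

/-- The span of products of generalised Legendre polynomials is everything. -/
lemma legP_span {A : Type*} [CommRing A] [Algebra ℝ A] (s p : A) (f : A)
    (hf : f ∈ Algebra.adjoin ℝ ({s, p} : Set A)) :
    f ∈ Submodule.span ℝ (Set.range fun q : ℕ × ℕ => legP s p q.1 * legP s p q.2) := by
  set S := Submodule.span ℝ (Set.range fun q : ℕ × ℕ => legP s p q.1 * legP s p q.2) with hS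
  have hQ : ∀ m n, legP s p m * legP s p n ∈ S := fun m n =>
    Submodule.subset_span ⟨(m, n), rfl⟩
  have hrec : ∀ n : ℕ, ((n : ℝ) + 1) • legP s p (n + 1) =
      (2 * (n : ℝ) + 1) • (s * legP s p n) - (n : ℝ) • (p * legP s p (n - 1)) := by
    intro n
    rcases n with _ | n
    · simp [legP]
    · have := legP_rec s p n
      rw [Nat.add_sub_cancel]
      push_cast
      rw [show (n : ℝ) + 1 + 1 = n + 2 by ring, show 2 * ((n : ℝ) + 1) + 1 = 2 * n + 3 by ring]
      exact this
  have hp : ∀ m n, p * (legP s p m * legP s p n) ∈ S := by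
    intro m
    induction m with
    | zero =>
      intro n
      have e : p * (legP s p 0 * legP s p n) = (-1 / ((n : ℝ) + 1)) •
          (((n : ℝ) + 2) • (legP s p 0 * legP s p (n + 2)) -
            (2 * (n : ℝ) + 3) • (legP s p 1 * legP s p (n + 1))) := by
        have h1 := legP_rec s p n
        have : ((n : ℝ) + 2) • (legP s p 0 * legP s p (n + 2)) -
            (2 * (n : ℝ) + 3) • (legP s p 1 * legP s p (n + 1)) =
            (-((n : ℝ) + 1)) • (p * (legP s p 0 * legP s p n)) := by
          simp only [legP.eq_1, legP.eq_2, one_mul, h1]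
          module
        rw [this, smul_smul]
        have : (-1 / ((n : ℝ) + 1)) * (-((n : ℝ) + 1)) = 1 := by field_simp
        rw [this, one_smul]
      rw [e]
      exact S.smul_mem _ (S.sub_mem (S.smul_mem _ (hQ _ _)) (S.smul_mem _ (hQ _ _)))
    | succ m ih =>
      intro n
      have h1 := legP_rec s p n
      have h2 := legP_rec s p m
      have e : (((n : ℝ) + 1) * (2 * m + 3)) • (p * (legP s p (m + 1) * legP s p n)) =
          (((m : ℝ) + 1) * (2 * n + 3)) • (p * (legP s p m * legP s p (n + 1))) -
          ((n + 2 : ℝ) * (2 * m + 3)) • (legP s p (m + 1) * legP s p (n + 2)) +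
          ((m + 2 : ℝ) * (2 * n + 3)) • (legP s p (m + 2) * legP s p (n + 1)) := by
        simp only [Algebra.smul_def, map_mul, map_add, map_natCast, map_ofNat, map_one] at h1 h2 ⊢
        linear_combination ((2 * (m : A) + 3) * legP s p (m + 1)) * h1 -
          ((2 * (n : A) + 3) * legP s p (n + 1)) * h2
      have hne : (((n : ℝ) + 1) * (2 * m + 3)) ≠ 0 := by positivity
      rw [← S.smul_mem_iff hne, e]
      exact S.add_mem (S.sub_mem (S.smul_mem _ (ih _)) (S.smul_mem _ (hQ _ _)))
        (S.smul_mem _ (hQ _ _))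
  have hs : ∀ m n, s * (legP s p m * legP s p n) ∈ S := by
    intro m n
    have hne : (2 * (m : ℝ) + 1) ≠ 0 := by positivity
    have e : (2 * (m : ℝ) + 1) • (s * (legP s p m * legP s p n)) =
        ((m : ℝ) + 1) • (legP s p (m + 1) * legP s p n) +
        (m : ℝ) • (p * (legP s p (m - 1) * legP s p n)) := by
      have h1 := hrec m
      simp only [Algebra.smul_def, map_mul, map_add, map_natCast, map_ofNat, map_one] at h1 ⊢
      linear_combination (- legP s p n) * h1
    rw [← S.smul_mem_iff hne, e]
    exact S.add_mem (S.smul_mem _ (hQ _ _)) (S.smul_mem _ (hp _ _))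
  have ext : ∀ a : A, (∀ m n, a * (legP s p m * legP s p n) ∈ S) → ∀ g ∈ S, a * g ∈ S := by
    intro a ha g hg
    induction hg using Submodule.span_induction with
    | mem g hg => obtain ⟨q, rfl⟩ := hg; exact ha _ _
    | zero => simp
    | add g g' _ _ h h' => rw [mul_add]; exact S.add_mem h h'
    | smul r g _ h => rw [mul_smul_comm]; exact S.smul_mem _ h
  have main : ∀ g ∈ S, f * g ∈ S := by
    induction hf using Algebra.adjoin_induction with
    | mem a ha =>
      rcases ha with rfl | rfl
      · exact ext _ hs
      · exact ext _ hp
    | algebraMap r =>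
      intro g hg; rw [← Algebra.smul_def]; exact S.smul_mem _ hg
    | add a b _ _ ha hb => intro g hg; rw [add_mul]; exact S.add_mem (ha g hg) (hb g hg)
    | mul a b _ _ ha hb => intro g hg; rw [mul_assoc]; exact ha _ (hb g hg)
  have h1 : (1 : A) ∈ S := by simpa [legP] using hQ 0 0
  simpa using main 1 h1

lemma geom_rem {k c : ℝ} (hk : k + c ≠ 0) (hc : c ≠ 0) (m : ℕ) :
    1 / (k + c) - ∑ j ∈ Finset.range m, (-1) ^ j / c ^ (j + 1) * k ^ j =
      (-1) ^ m * k ^ m / (c ^ m * (k + c)) := by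
  induction m with
  | zero => simp
  | succ m ih =>
    rw [Finset.sum_range_succ, ← sub_sub, ih]
    field_simp
    ring

lemma kernel_expand {x y c M : ℝ} (h : y < x) (hy : 0 < y) (hM : x ≤ M) (hc : 0 < c) (m : ℕ) :
    |1 / Real.sqrt ((x + c) * (y + c)) -
      ∑ j ∈ Finset.range m, (-1) ^ j / c ^ (j + 1) * legP ((x + y) / 2) (x * y) j| ≤
      M ^ m / c ^ (m + 1) := by
  have hpi := Real.pi_pos
  have hI : ∀ j : ℕ, IntervalIntegrable
      (fun k : ℝ => k ^ j * (1 / Real.sqrt ((x - k) * (k - y)))) volume y x :=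
    fun m => kernel_intervalIntegrable h _ (by fun_prop)
  have hC : IntervalIntegrable
      (fun k : ℝ => 1 / (k + c) * (1 / Real.sqrt ((x - k) * (k - y)))) volume y x := by
    apply kernel_intervalIntegrable h
    apply ContinuousOn.div (by fun_prop) (by fun_prop)
    intro k hk
    have : 0 < k + c := by linarith [hk.1]
    exact this.ne'
  have e1 : ∫ k in y..x, 1 / (k + c) * (1 / Real.sqrt ((x - k) * (k - y))) =
      Real.pi * (1 / Real.sqrt ((x + c) * (y + c))) := by
    rw [mul_one_div, ← kernel_cauchy h (by linarith : 0 < y + c)]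
    congr 1; ext k; rw [div_mul_div_comm, one_mul]
  have key : ∫ k in y..x, (1 / (k + c) - ∑ j ∈ Finset.range m, (-1) ^ j / c ^ (j + 1) * k ^ j) *
      (1 / Real.sqrt ((x - k) * (k - y))) = Real.pi * (1 / Real.sqrt ((x + c) * (y + c)) -
      ∑ j ∈ Finset.range m, (-1) ^ j / c ^ (j + 1) * legP ((x + y) / 2) (x * y) j) := by
    have e2 : ∀ k : ℝ, (1 / (k + c) - ∑ j ∈ Finset.range m, (-1) ^ j / c ^ (j + 1) * k ^ j) *
      (1 / Real.sqrt ((x - k) * (k - y))) = 1 / (k + c) * (1 / Real.sqrt ((x - k) * (k - y))) -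
      ∑ j ∈ Finset.range m, (-1) ^ j / c ^ (j + 1) *
        (k ^ j * (1 / Real.sqrt ((x - k) * (k - y)))) := by
      intro k
      rw [sub_mul, Finset.sum_mul]
      simp only [mul_assoc]
    have hSum : IntervalIntegrable (fun k : ℝ => ∑ j ∈ Finset.range m, (-1) ^ j / c ^ (j + 1) *
        (k ^ j * (1 / Real.sqrt ((x - k) * (k - y))))) volume y x := by
      rw [intervalIntegrable_iff_integrableOn_Ioc_of_le h.le]
      refine integrable_finsetSum _ (fun j _ => Integrable.const_mul ?_ _)
      exact (intervalIntegrable_iff_integrableOn_Ioc_of_le h.le).1 (hI j)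
    simp only [e2]
    rw [intervalIntegral.integral_sub hC hSum, e1,
      intervalIntegral.integral_finsetSum (fun j _ => (hI j).const_mul _), mul_sub,
      Finset.mul_sum]
    congr 1
    apply Finset.sum_congr rfl
    intro j _
    rw [intervalIntegral.integral_const_mul, kernel_moment h]
    ring
  have hb : ‖∫ k in y..x, (1 / (k + c) - ∑ j ∈ Finset.range m, (-1) ^ j / c ^ (j + 1) * k ^ j) *
      (1 / Real.sqrt ((x - k) * (k - y)))‖ ≤
      ∫ k in y..x, (M ^ m / c ^ (m + 1)) * (1 / Real.sqrt ((x - k) * (k - y))) := by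
    apply intervalIntegral.norm_integral_le_of_norm_le h.le
    · filter_upwards with k hk
      have hk0 : 0 < k := by linarith [hk.1]
      have hkM : k ≤ M := hk.2.trans hM
      rw [norm_mul, Real.norm_of_nonneg (by positivity : 0 ≤ 1 / Real.sqrt ((x - k) * (k - y)))]
      gcongr
      rw [geom_rem (by positivity) hc.ne']
      rw [norm_div, norm_mul, norm_pow, norm_neg, norm_one, one_pow, one_mul,
        Real.norm_of_nonneg (by positivity), Real.norm_of_nonneg (by positivity), pow_succ]
      have : c ≤ k + c := by linarith
      have hM0 : 0 < M := by linarith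
      gcongr
    · exact ((intervalIntegrable_iff_integrableOn_Ioc_of_le h.le).2 (kernel_mass h).1).const_mul _
  rw [key, intervalIntegral.integral_const_mul, (kernel_mass h).2, norm_mul,
    Real.norm_of_nonneg hpi.le, mul_comm, Real.norm_eq_abs] at hb
  exact le_of_mul_le_mul_right hb hpi

lemma continuous_legP (n : ℕ) :
    Continuous (fun p : ℝ × ℝ => legP ((p.1 + p.2) / 2) (p.1 * p.2) n) := by
  induction n using Nat.strong_induction_on with
  | _ n ih =>
    rcases n with _ | _ | n
    · simp only [legP]; fun_prop
    · simp only [legP]; fun_prop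
    · have h1 := ih n (by omega)
      have h2 := ih (n + 1) (by omega)
      simp only [legP]
      fun_prop

lemma integrable_mul_cont {ν₁ ν₀ : ℝ} {G f : ℝ × ℝ → ℝ}
    (hG : IntegrableOn G (Ioo ν₁ ν₀ ×ˢ Ioo 0 ν₁))
    (hf : ContinuousOn f (Icc ν₁ ν₀ ×ˢ Icc 0 ν₁)) :
    IntegrableOn (fun p => G p * f p) (Ioo ν₁ ν₀ ×ˢ Ioo 0 ν₁) := by
  have hsub : Ioo ν₁ ν₀ ×ˢ Ioo 0 ν₁ ⊆ Icc ν₁ ν₀ ×ˢ Icc 0 ν₁ :=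
    prod_mono Ioo_subset_Icc_self Ioo_subset_Icc_self
  have hms : MeasurableSet (Ioo ν₁ ν₀ ×ˢ Ioo (0:ℝ) ν₁) := measurableSet_Ioo.prod measurableSet_Ioo
  obtain ⟨C, hC⟩ := (isCompact_Icc.prod isCompact_Icc).exists_bound_of_continuousOn hf
  refine Integrable.mul_bdd (c := C) hG ((hf.mono hsub).aestronglyMeasurable hms) ?_
  filter_upwards [ae_restrict_mem hms] with p hp using hC p (hsub hp)

lemma fubini_step {ν₁ ν₀ : ℝ} (h0 : 0 < ν₁) (h1 : ν₁ < ν₀) (G : ℝ × ℝ → ℝ)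
    (hG : IntegrableOn G (Ioo ν₁ ν₀ ×ˢ Ioo 0 ν₁))
    (hA : ∀ k ∈ Ioo 0 ν₁, ∫ p in Ioo ν₁ ν₀ ×ˢ Ioo 0 k,
      1 / Real.sqrt ((p.1 - k) * (k - p.2)) * G p = 0)
    (hB : ∀ k ∈ Ioo ν₁ ν₀, ∫ p in Ioo k ν₀ ×ˢ Ioo 0 ν₁,
      1 / Real.sqrt ((p.1 - k) * (k - p.2)) * G p = 0) (n : ℕ) :
    ∫ p in Ioo ν₁ ν₀ ×ˢ Ioo 0 ν₁, G p * legP ((p.1 + p.2) / 2) (p.1 * p.2) n = 0 := by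
  set R := Ioo ν₁ ν₀ ×ˢ Ioo 0 ν₁ with hR
  have hms : MeasurableSet R := measurableSet_Ioo.prod measurableSet_Ioo
  set T : Set ((ℝ × ℝ) × ℝ) := {q | q.1.2 < q.2 ∧ q.2 < q.1.1} with hT
  have hTm : MeasurableSet T :=
    (measurableSet_lt (f := fun q : (ℝ × ℝ) × ℝ => q.1.2) (g := fun q => q.2)
      (by fun_prop) (by fun_prop)).inter
    (measurableSet_lt (f := fun q : (ℝ × ℝ) × ℝ => q.2) (g := fun q => q.1.1)
      (by fun_prop) (by fun_prop))
  let F : ℝ × ℝ → ℝ → ℝ := fun p k => T.indicator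
    (fun q => q.2 ^ n * (1 / Real.sqrt ((q.1.1 - q.2) * (q.2 - q.1.2)))) (p, k) * G p
  have hF1 : ∀ p k, F p k = (Ioo p.2 p.1).indicator
      (fun k => k ^ n * (1 / Real.sqrt ((p.1 - k) * (k - p.2)))) k * G p := by
    intro p k
    simp only [F, indicator, hT, mem_ofPred_eq, mem_Ioo]
  have hF2 : ∀ p k, F p k = k ^ n * ({p : ℝ × ℝ | p.2 < k ∧ k < p.1}.indicator
      (fun p => 1 / Real.sqrt ((p.1 - k) * (k - p.2)) * G p) p) := by
    intro p k
    simp only [F, indicator, hT, mem_ofPred_eq]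
    split_ifs <;> ring
  have hlt : ∀ p ∈ R, p.2 < p.1 := fun p hp => hp.2.2.trans hp.1.1
  have hint1 : ∀ p : ℝ × ℝ, p.2 < p.1 → Integrable ((Ioo p.2 p.1).indicator
      (fun k => k ^ n * (1 / Real.sqrt ((p.1 - k) * (k - p.2))))) := by
    intro p hp
    rw [integrable_indicator_iff measurableSet_Ioo]
    have := kernel_intervalIntegrable hp (fun k => k ^ n) (by fun_prop)
    rw [intervalIntegrable_iff_integrableOn_Ioc_of_le hp.le] at this
    exact this.mono_set Ioo_subset_Ioc_self
  have hval1 : ∀ p : ℝ × ℝ, p.2 < p.1 → ∫ k, (Ioo p.2 p.1).indicator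
      (fun k => k ^ n * (1 / Real.sqrt ((p.1 - k) * (k - p.2)))) k =
      Real.pi * legP ((p.1 + p.2) / 2) (p.1 * p.2) n := by
    intro p hp
    rw [integral_indicator measurableSet_Ioo, ← integral_Ioc_eq_integral_Ioo,
      ← intervalIntegral.integral_of_le hp.le, kernel_moment hp]
  have hmeas : AEStronglyMeasurable (Function.uncurry F)
      ((volume.restrict R).prod (volume : Measure ℝ)) := by
    apply AEStronglyMeasurable.mul
    · apply Measurable.aestronglyMeasurable
      apply Measurable.indicator _ hTm
      fun_prop
    · exact hG.aestronglyMeasurable.comp_fst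
  have hFint : Integrable (Function.uncurry F)
      ((volume.restrict R).prod (volume : Measure ℝ)) := by
    rw [integrable_prod_iff hmeas]
    constructor
    · filter_upwards [ae_restrict_mem hms] with p hp
      simp only [Function.uncurry, hF1]
      exact (hint1 p (hlt p hp)).mul_const _
    · have : Integrable (fun p => ‖G p‖ * (Real.pi * legP ((p.1 + p.2) / 2) (p.1 * p.2) n))
          (volume.restrict R) := by
        apply integrable_mul_cont hG.norm
        exact (continuous_const.mul (continuous_legP n)).continuousOn
      refine this.congr ?_
      filter_upwards [ae_restrict_mem hms] with p hp
      simp only [Function.uncurry, hF1, norm_mul]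
      rw [integral_mul_const, mul_comm, ← hval1 p (hlt p hp)]
      congr 1
      congr 1
      ext k
      rw [Real.norm_of_nonneg]
      apply indicator_nonneg
      intro k hk
      have : 0 < k := hp.2.1.trans hk.1
      positivity
  have hswap := integral_integral_swap hFint
  have hright : ∫ k, ∫ p in R, F p k = 0 := by
    apply integral_eq_zero_of_ae
    have hne : ∀ᵐ k : ℝ, k ≠ ν₁ := by
      simp [ae_iff]
    filter_upwards [hne] with k hk
    have hm : MeasurableSet {p : ℝ × ℝ | p.2 < k ∧ k < p.1} :=
      (measurableSet_lt (f := fun p : ℝ × ℝ => p.2) (g := fun _ => k)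
        (by fun_prop) (by fun_prop)).inter
      (measurableSet_lt (f := fun _ : ℝ × ℝ => k) (g := fun p => p.1)
        (by fun_prop) (by fun_prop))
    simp only [hF2, Pi.zero_apply]
    rw [integral_const_mul, setIntegral_indicator hm]
    apply mul_eq_zero_of_right
    rcases lt_or_gt_of_ne hk with hk | hk
    · by_cases hk0 : 0 < k
      · rw [← hA k ⟨hk0, hk⟩]
        congr 2
        ext ⟨x, y⟩
        simp only [hR, mem_inter_iff, mem_prod, mem_Ioo, mem_ofPred_eq]
        constructor
        · rintro ⟨⟨⟨_, _⟩, _, _⟩, _, _⟩; refine ⟨⟨?_, ?_⟩, ?_, ?_⟩ <;> linarith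
        · rintro ⟨⟨_, _⟩, _, _⟩; refine ⟨⟨⟨?_, ?_⟩, ?_, ?_⟩, ?_, ?_⟩ <;> linarith
      · have : R ∩ {p : ℝ × ℝ | p.2 < k ∧ k < p.1} = ∅ := by
          ext ⟨x, y⟩
          simp only [hR, mem_inter_iff, mem_prod, mem_Ioo, mem_ofPred_eq, mem_empty_iff_false,
            iff_false]
          rintro ⟨⟨⟨_, _⟩, _, _⟩, _, _⟩; linarith
        rw [this]; simp
    · by_cases hk0 : k < ν₀
      · rw [← hB k ⟨hk, hk0⟩]
        congr 2
        ext ⟨x, y⟩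
        simp only [hR, mem_inter_iff, mem_prod, mem_Ioo, mem_ofPred_eq]
        constructor
        · rintro ⟨⟨⟨_, _⟩, _, _⟩, _, _⟩; refine ⟨⟨?_, ?_⟩, ?_, ?_⟩ <;> linarith
        · rintro ⟨⟨_, _⟩, _, _⟩; refine ⟨⟨⟨?_, ?_⟩, ?_, ?_⟩, ?_, ?_⟩ <;> linarith
      · have : R ∩ {p : ℝ × ℝ | p.2 < k ∧ k < p.1} = ∅ := by
          ext ⟨x, y⟩
          simp only [hR, mem_inter_iff, mem_prod, mem_Ioo, mem_ofPred_eq, mem_empty_iff_false,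
            iff_false]
          rintro ⟨⟨⟨_, _⟩, _, _⟩, _, _⟩; linarith
        rw [this]; simp
  have hleft : ∫ p in R, ∫ k, F p k =
      ∫ p in R, Real.pi * (G p * legP ((p.1 + p.2) / 2) (p.1 * p.2) n) := by
    apply setIntegral_congr_fun hms
    intro p hp
    simp only [hF1]
    rw [integral_mul_const, hval1 p (hlt p hp)]
    ring
  rw [hright, hleft, integral_const_mul] at hswap
  exact (mul_eq_zero.1 hswap).resolve_left Real.pi_ne_zero

/-- Expansion at infinity in the first parameter. -/
lemma moment_step {ν₁ ν₀ : ℝ} (h1 : ν₁ < ν₀) (h0 : 0 < ν₁) (H : ℝ × ℝ → ℝ)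
    (hH : IntegrableOn H (Ioo ν₁ ν₀ ×ˢ Ioo 0 ν₁))
    (hz : ∀ c : ℝ, 0 < c → ∫ p in Ioo ν₁ ν₀ ×ˢ Ioo 0 ν₁,
      H p * (1 / Real.sqrt ((p.1 + c) * (p.2 + c))) = 0) (m : ℕ) :
    ∫ p in Ioo ν₁ ν₀ ×ˢ Ioo 0 ν₁, H p * legP ((p.1 + p.2) / 2) (p.1 * p.2) m = 0 := by
  set R := Ioo ν₁ ν₀ ×ˢ Ioo 0 ν₁ with hR
  have hms : MeasurableSet R := measurableSet_Ioo.prod measurableSet_Ioo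
  have hlt : ∀ p ∈ R, p.2 < p.1 := fun p hp => hp.2.2.trans hp.1.1
  have hIP : ∀ j, IntegrableOn (fun p => H p * legP ((p.1 + p.2) / 2) (p.1 * p.2) j) R :=
    fun j => integrable_mul_cont hH (continuous_legP j).continuousOn
  induction m using Nat.strong_induction_on with
  | _ m ih =>
  set L := ∫ p in R, H p * legP ((p.1 + p.2) / 2) (p.1 * p.2) m with hL
  set C := ν₀ ^ (m + 1) * ∫ p in R, ‖H p‖ with hC
  have hbound : ∀ c : ℝ, 0 < c → |L| ≤ C / c := by
    intro c hc
    have hIg : IntegrableOn (fun p => H p * (1 / Real.sqrt ((p.1 + c) * (p.2 + c)))) R := by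
      apply integrable_mul_cont hH
      apply ContinuousOn.div (by fun_prop) (by fun_prop)
      rintro ⟨x, y⟩ ⟨hx, hy⟩
      have a1 : 0 < x + c := by linarith [hx.1]
      have a2 : 0 < y + c := by linarith [hy.1]
      exact (Real.sqrt_pos.2 (mul_pos a1 a2)).ne'
    have e : ∫ p in R, H p * (1 / Real.sqrt ((p.1 + c) * (p.2 + c)) -
        ∑ j ∈ Finset.range (m + 1), (-1) ^ j / c ^ (j + 1) *
          legP ((p.1 + p.2) / 2) (p.1 * p.2) j) = -((-1) ^ m / c ^ (m + 1) * L) := by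
      have e0 : ∀ p : ℝ × ℝ, H p * (1 / Real.sqrt ((p.1 + c) * (p.2 + c)) -
        ∑ j ∈ Finset.range (m + 1), (-1) ^ j / c ^ (j + 1) *
          legP ((p.1 + p.2) / 2) (p.1 * p.2) j) = H p * (1 / Real.sqrt ((p.1 + c) * (p.2 + c))) -
          ∑ j ∈ Finset.range (m + 1), (-1) ^ j / c ^ (j + 1) *
          (H p * legP ((p.1 + p.2) / 2) (p.1 * p.2) j) := by
        intro p
        rw [mul_sub, Finset.mul_sum]
        congr 1
        apply Finset.sum_congr rfl
        intro j _; ring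
      simp only [e0]
      rw [integral_sub hIg (integrable_finsetSum _ (fun j _ => (hIP j).const_mul _)), hz c hc,
        integral_finsetSum _ (fun j _ => (hIP j).const_mul _)]
      simp only [integral_const_mul]
      rw [Finset.sum_range_succ, Finset.sum_eq_zero]
      · simp [hL]
      · intro j hj
        rw [ih j (Finset.mem_range.1 hj), mul_zero]
    have hb : ‖∫ p in R, H p * (1 / Real.sqrt ((p.1 + c) * (p.2 + c)) -
        ∑ j ∈ Finset.range (m + 1), (-1) ^ j / c ^ (j + 1) *
          legP ((p.1 + p.2) / 2) (p.1 * p.2) j)‖ ≤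
        ∫ p in R, ‖H p‖ * (ν₀ ^ (m + 1) / c ^ (m + 2)) := by
      apply norm_integral_le_of_norm_le (hH.norm.mul_const _)
      filter_upwards [ae_restrict_mem hms] with p hp
      rw [norm_mul]
      gcongr
      exact kernel_expand (hlt p hp) hp.2.1 hp.1.2.le hc (m + 1)
    rw [e, integral_mul_const, norm_neg, norm_mul, norm_div, norm_pow, norm_neg, norm_one,
      one_pow, Real.norm_of_nonneg (by positivity : 0 ≤ c ^ (m + 1)), Real.norm_eq_abs] at hb
    have hcm : 0 < c ^ (m + 1) := by positivity
    calc |L| = c ^ (m + 1) * (1 / c ^ (m + 1) * |L|) := by field_simp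
      _ ≤ c ^ (m + 1) * ((∫ p in R, ‖H p‖) * (ν₀ ^ (m + 1) / c ^ (m + 2))) := by gcongr
      _ = C / c := by rw [hC]; field_simp; ring
  by_contra hne
  have hLpos : 0 < |L| := abs_pos.2 hne
  have hCn : 0 ≤ C := by
    have : 0 < ν₀ := h0.trans h1
    have : 0 ≤ ∫ p in R, ‖H p‖ := integral_nonneg fun p => norm_nonneg _
    positivity
  have := hbound ((C + 1) / |L|) (by positivity)
  rw [div_div_eq_mul_div, le_div_iff₀ (by positivity)] at this
  nlinarith

lemma legP_coe (n : ℕ) (s p : C(ℝ × ℝ, ℝ)) (q : ℝ × ℝ) :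
    (legP s p n : C(ℝ × ℝ, ℝ)) q = legP (s q) (p q) n := by
  induction n using Nat.strong_induction_on with
  | _ n ih =>
    rcases n with _ | _ | n
    · simp [legP]
    · simp [legP]
    · have h1 := ih n (by omega)
      have h2 := ih (n + 1) (by omega)
      simp [legP, h1, h2]

/-- Injectivity of the Radon transform in the action variables for
3-dimensional Liouville billiard tables of classical type (cases (A) and (B)). -/
theorem stmt_0 (ν₃ ν₁ ν₀ : ℝ) (hν₃ : ν₃ < 0) (h0ν₁ : 0 < ν₁) (hν₁ν₀ : ν₁ < ν₀)
    (W : ℝ × ℝ → ℝ) (hW : ContinuousOn W (Icc ν₁ ν₀ ×ˢ Icc 0 ν₁))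
    (K : ℝ × ℝ → ℝ)
    (hK : ∀ x₁ x₂ : ℝ, K (x₁, x₂) =
      W (x₁, x₂) / (Real.sqrt (x₁ - ν₁) * Real.sqrt (ν₀ - x₁) *
        Real.sqrt x₂ * Real.sqrt (ν₁ - x₂)))
    (hKint : IntegrableOn K (Ioo ν₁ ν₀ ×ˢ Ioo 0 ν₁))
    (hAint : ∀ κ₁ κ₂ : ℝ, κ₁ < 0 → κ₂ ∈ Ioo 0 ν₁ →
      IntegrableOn (fun p : ℝ × ℝ => K p /
        (Real.sqrt ((p.1 - κ₁) * (p.2 - κ₁)) * Real.sqrt ((p.1 - κ₂) * (κ₂ - p.2))))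
        (Ioo ν₁ ν₀ ×ˢ Ioo 0 κ₂))
    (hA : ∀ κ₁ κ₂ : ℝ, κ₁ < 0 → κ₂ ∈ Ioo 0 ν₁ →
      ∫ p in Ioo ν₁ ν₀ ×ˢ Ioo 0 κ₂, K p /
        (Real.sqrt ((p.1 - κ₁) * (p.2 - κ₁)) * Real.sqrt ((p.1 - κ₂) * (κ₂ - p.2))) = 0)
    (hBint : ∀ κ₁ κ₂ : ℝ, κ₁ < 0 → κ₂ ∈ Ioo ν₁ ν₀ →
      IntegrableOn (fun p : ℝ × ℝ => K p /
        (Real.sqrt ((p.1 - κ₁) * (p.2 - κ₁)) * Real.sqrt ((p.1 - κ₂) * (κ₂ - p.2))))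
        (Ioo κ₂ ν₀ ×ˢ Ioo 0 ν₁))
    (hB : ∀ κ₁ κ₂ : ℝ, κ₁ < 0 → κ₂ ∈ Ioo ν₁ ν₀ →
      ∫ p in Ioo κ₂ ν₀ ×ˢ Ioo 0 ν₁, K p /
        (Real.sqrt ((p.1 - κ₁) * (p.2 - κ₁)) * Real.sqrt ((p.1 - κ₂) * (κ₂ - p.2))) = 0) :
    ∀ p ∈ Icc ν₁ ν₀ ×ˢ Icc 0 ν₁, W p = 0 := by
  set R := Ioo ν₁ ν₀ ×ˢ Ioo 0 ν₁ with hR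
  set Rc := Icc ν₁ ν₀ ×ˢ Icc 0 ν₁ with hRc
  have hsub : R ⊆ Rc := prod_mono Ioo_subset_Icc_self Ioo_subset_Icc_self
  have hms : MeasurableSet R := measurableSet_Ioo.prod measurableSet_Ioo
  have hopen : IsOpen R := isOpen_Ioo.prod isOpen_Ioo
  -- all product moments vanish
  have hmom : ∀ m n : ℕ, ∫ p in R, K p * (legP ((p.1 + p.2) / 2) (p.1 * p.2) m *
      legP ((p.1 + p.2) / 2) (p.1 * p.2) n) = 0 := by
    intro m n
    have := moment_step hν₁ν₀ h0ν₁ (fun p => K p * legP ((p.1 + p.2) / 2) (p.1 * p.2) m)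
      (integrable_mul_cont hKint (continuous_legP m).continuousOn) ?_ n
    · simpa only [mul_assoc] using this
    intro c hc
    have hG : IntegrableOn (fun p => K p * (1 / Real.sqrt ((p.1 + c) * (p.2 + c)))) R := by
      apply integrable_mul_cont hKint
      apply ContinuousOn.div (by fun_prop) (by fun_prop)
      rintro ⟨x, y⟩ ⟨hx, hy⟩
      have a1 : 0 < x + c := by linarith [hx.1]
      have a2 : 0 < y + c := by linarith [hy.1]
      exact (Real.sqrt_pos.2 (mul_pos a1 a2)).ne'
    have e : ∀ (k : ℝ) (p : ℝ × ℝ), 1 / Real.sqrt ((p.1 - k) * (k - p.2)) *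
        (K p * (1 / Real.sqrt ((p.1 + c) * (p.2 + c)))) = K p /
        (Real.sqrt ((p.1 - (-c)) * (p.2 - (-c))) * Real.sqrt ((p.1 - k) * (k - p.2))) := by
      intro k p
      simp only [sub_neg_eq_add]
      rw [mul_comm, mul_assoc, div_mul_div_comm, one_mul, mul_one_div]
    have := fubini_step h0ν₁ hν₁ν₀ _ hG ?_ ?_ m
    · refine Eq.trans ?_ this
      congr 1; ext p; ring
    · intro k hk
      simp only [e]
      exact hA (-c) k (by linarith) hk
    · intro k hk
      simp only [e]
      exact hB (-c) k (by linarith) hk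
  -- hence integrals against the algebra generated by `x + y`, `x y` vanish
  let s : C(ℝ × ℝ, ℝ) := ⟨fun q => (q.1 + q.2) / 2, by fun_prop⟩
  let p : C(ℝ × ℝ, ℝ) := ⟨fun q => q.1 * q.2, by fun_prop⟩
  have halg : ∀ f ∈ Algebra.adjoin ℝ ({s, p} : Set C(ℝ × ℝ, ℝ)), ∫ q in R, K q * f q = 0 := by
    intro f hf
    have hf' := legP_span s p f hf
    clear hf
    induction hf' using Submodule.span_induction with
    | mem g hg =>
      obtain ⟨⟨m, n⟩, rfl⟩ := hg
      simp only [ContinuousMap.mul_apply, legP_coe]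
      exact hmom m n
    | zero => simp
    | add g g' hg hg' h h' =>
      have i1 := integrable_mul_cont hKint (f := g) g.continuous.continuousOn
      have i2 := integrable_mul_cont hKint (f := g') g'.continuous.continuousOn
      simp only [ContinuousMap.add_apply, mul_add]
      rw [integral_add i1 i2, h, h', add_zero]
    | smul r g _ h =>
      simp only [ContinuousMap.smul_apply, smul_eq_mul, mul_left_comm _ r]
      rw [integral_const_mul, h, mul_zero]
  have hKW : ∫ q in R, K q * W q = 0 := by
    have happrox : ∀ ε : ℝ, 0 < ε → ∃ f ∈ Algebra.adjoin ℝ ({s, p} : Set C(ℝ × ℝ, ℝ)),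
        ∀ q ∈ Rc, |W q - f q| ≤ ε := by
      intro ε hε
      have hcpt : CompactSpace Rc :=
        isCompact_iff_compactSpace.1 (isCompact_Icc.prod isCompact_Icc)
      let res : C(ℝ × ℝ, ℝ) →ₐ[ℝ] C(Rc, ℝ) :=
        ContinuousMap.compRightAlgHom ℝ ℝ ⟨Subtype.val, continuous_subtype_val⟩
      have hres : ∀ (g : C(ℝ × ℝ, ℝ)) (q : Rc), res g q = g q := fun g q => rfl
      let A := (Algebra.adjoin ℝ ({s, p} : Set C(ℝ × ℝ, ℝ))).map res
      have hsep : A.SeparatesPoints := by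
        rintro ⟨⟨x, y⟩, hx, hy⟩ ⟨⟨x', y'⟩, hx', hy'⟩ hne
        by_contra hcon
        have hall : ∀ g ∈ Algebra.adjoin ℝ ({s, p} : Set C(ℝ × ℝ, ℝ)), g (x, y) = g (x', y') := by
          intro g hg
          by_contra hg'
          exact hcon ⟨_, ⟨res g, ⟨g, hg, rfl⟩, rfl⟩, hg'⟩
        have e1 : (x + y) / 2 = (x' + y') / 2 := hall s (Algebra.subset_adjoin (by simp))
        have e2 : x * y = x' * y' := hall p (Algebra.subset_adjoin (by simp))
        have hx1 := hx.1
        have hy1 := hy.2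
        have hx2 := hx'.1
        have hy2 := hy'.2
        simp only at hx1 hy1 hx2 hy2
        have e3 : (x - x') * (x - y') = 0 := by
          have : y = x' + y' - x := by linarith
          rw [this] at e2; linarith
        have hxx : x = x' := by
          rcases mul_eq_zero.1 e3 with h | h
          · linarith
          · linarith
        have hyy : y = y' := by linarith
        subst hxx hyy
        exact hne rfl
      obtain ⟨⟨g, hg⟩, hgW⟩ :=
        ContinuousMap.exists_mem_subalgebra_near_continuous_of_separatesPoints A hsep
          (fun q : Rc => W q) (continuousOn_iff_continuous_domRestrict.1 hW) ε hε
      obtain ⟨f, hf, rfl⟩ := hg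
      refine ⟨f, hf, fun q hq => ?_⟩
      have := hgW ⟨q, hq⟩
      rw [abs_sub_comm]
      exact this.le
    set C := ∫ q in R, ‖K q‖ with hC
    have hC0 : 0 ≤ C := integral_nonneg fun _ => norm_nonneg _
    have hbd : ∀ ε : ℝ, 0 < ε → |∫ q in R, K q * W q| ≤ C * ε := by
      intro ε hε
      obtain ⟨f, hf, hfW⟩ := happrox ε hε
      have i1 := integrable_mul_cont hKint hW
      have i2 := integrable_mul_cont hKint (f := f) f.continuous.continuousOn
      have e : ∫ q in R, K q * W q = ∫ q in R, K q * (W q - f q) := by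
        simp only [mul_sub]
        rw [integral_sub i1 i2, halg f hf, sub_zero]
      rw [e, hC, ← integral_mul_const, ← Real.norm_eq_abs]
      apply norm_integral_le_of_norm_le (hKint.norm.mul_const _)
      filter_upwards [ae_restrict_mem hms] with q hq
      rw [norm_mul]
      gcongr
      exact hfW q (hsub hq)
    by_contra hne
    have hpos := abs_pos.2 hne
    have := hbd (|∫ q in R, K q * W q| / (2 * (C + 1))) (by positivity)
    rw [mul_div_assoc', le_div_iff₀ (by positivity)] at this
    nlinarith
  have hnn : ∀ q ∈ R, 0 ≤ K q * W q := by
    rintro ⟨x, y⟩ _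
    rw [hK, div_mul_eq_mul_div]
    exact div_nonneg (mul_self_nonneg _) (by positivity)
  have hae : ∀ᵐ q ∂(volume.restrict R), K q * W q = 0 := by
    have := (setIntegral_eq_zero_iff_of_nonneg_ae
      ((ae_restrict_mem hms).mono hnn) (integrable_mul_cont hKint hW)).1 hKW
    exact this
  have hWae : W =ᵐ[volume.restrict R] (fun _ => 0) := by
    filter_upwards [hae, ae_restrict_mem hms] with q hq hqR
    obtain ⟨x, y⟩ := q
    have h1 : 0 < x - ν₁ := by linarith [hqR.1.1]
    have h2 : 0 < ν₀ - x := by linarith [hqR.1.2]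
    have h3 : 0 < y := hqR.2.1
    have h4 : 0 < ν₁ - y := by linarith [hqR.2.2]
    have hD : 0 < Real.sqrt (x - ν₁) * Real.sqrt (ν₀ - x) * Real.sqrt y * Real.sqrt (ν₁ - y) := by
      have := Real.sqrt_pos.2 h1
      have := Real.sqrt_pos.2 h2
      have := Real.sqrt_pos.2 h3
      have := Real.sqrt_pos.2 h4
      positivity
    rw [hK, div_mul_eq_mul_div, div_eq_zero_iff] at hq
    exact mul_self_eq_zero.1 (hq.resolve_right hD.ne')
  have hEq : EqOn W (fun _ => 0) R :=
    Measure.eqOn_open_of_ae_eq hWae hopen (hW.mono hsub) continuousOn_const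
  have hcl : Rc ⊆ closure R := by
    rw [closure_prod_eq, closure_Ioo hν₁ν₀.ne, closure_Ioo h0ν₁.ne]
  exact hEq.of_subset_closure hW continuousOn_const hsub hcl
end

section
/- Let φ₁ and φ₂ be C^∞ real-valued functions on an open interval around 0 in ℝ such that both are even (φᵢ(−x) = φᵢ(x)) and their derivatives at 0 satisfy φ₁^{(2l)}(0) = (−1)^l φ₂^{(2l)}(0) for every integer l ≥ 0. Then there exist ε > 0 and a C^∞ function G defined on an open neighborhood of (0,0) in ℝ² such that for every (x₁,x₂) with 0 < x₁² + x₂² < ε one has (φ₁(x₁) − φ₂(x₂)) / (x₁² + x₂²) = G(x₁² − x₂², 2x₁x₂). If moreover φ₁ and φ₂ are real analytic, then G can be chosen real analytic. -/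
open Set

lemma aux_param (n : ℕ) : ∀ (F : Type) [NormedAddCommGroup F] [NormedSpace ℝ F] [CompleteSpace F]
    (f : (ℝ × ℝ) × ℝ → F), ContDiff ℝ (⊤ : ℕ∞) f →
    ContDiff ℝ n (fun x => ∫ s in (0:ℝ)..1, f (x, s)) := by
  induction n with
  | zero =>
    intro F _ _ _ f hf
    have := hf.continuous
    rw [Nat.cast_zero, contDiff_zero]
    exact intervalIntegral.continuous_parametric_intervalIntegral_of_continuous'
      (f := fun x s => f (x, s)) (by simpa [Function.uncurry_def] using this) 0 1
  | succ n ih =>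
    intro F _ _ _ f hf
    have hc := hf.continuous
    set D : (ℝ × ℝ) × ℝ → ((ℝ × ℝ) →L[ℝ] F) := fun p =>
      (fderiv ℝ f p).comp (ContinuousLinearMap.inl ℝ (ℝ × ℝ) ℝ) with hD
    have hDs : ContDiff ℝ (⊤ : ℕ∞) D := by
      have h1 : ContDiff ℝ (⊤ : ℕ∞) (fderiv ℝ f) := hf.fderiv_right (by simp)
      exact h1.clm_comp contDiff_const
    have hDc := hDs.continuous
    push_cast
    rw [contDiff_succ_iff_hasFDerivAt]
    refine ⟨fun x => ∫ s in (0:ℝ)..1, D (x, s), ih _ D hDs, fun x₀ => ?_⟩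
    have hK : IsCompact ((Metric.closedBall x₀ 1) ×ˢ (Icc (0:ℝ) 1)) :=
      (isCompact_closedBall x₀ 1).prod isCompact_Icc
    obtain ⟨C, hC⟩ := hK.exists_bound_of_continuousOn hDc.continuousOn
    refine intervalIntegral.hasFDerivAt_integral_of_dominated_of_fderiv_le
      (F := fun x s => f (x, s)) (F' := fun x s => D (x, s)) (bound := fun _ => C)
      (Metric.closedBall_mem_nhds x₀ one_pos) ?_ ?_ ?_ ?_ ?_ ?_
    · exact Filter.Eventually.of_forall fun x =>
        (Continuous.aestronglyMeasurable (by fun_prop))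
    · exact Continuous.intervalIntegrable (by fun_prop) _ _
    · exact (Continuous.aestronglyMeasurable (by fun_prop))
    · refine Filter.Eventually.of_forall fun t ht x hx => hC _ ⟨hx, ?_⟩
      rw [uIoc_of_le zero_le_one] at ht
      exact Ioc_subset_Icc_self ht
    · exact intervalIntegrable_const
    · refine Filter.Eventually.of_forall fun t ht x hx => ?_
      have h1 : HasFDerivAt f (fderiv ℝ f (x, t)) (x, t) :=
        (hf.differentiable (by simp)).differentiableAt.hasFDerivAt
      exact h1.comp x (hasFDerivAt_prodMk_left x t)

lemma aux_hadamard (g : ℝ × ℝ → ℝ) (hg : ContDiff ℝ (⊤ : ℕ∞) g) (h0 : ∀ t, g (t, 0) = 0) :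
    ∃ k : ℝ × ℝ → ℝ, ContDiff ℝ (⊤ : ℕ∞) k ∧ ∀ t r, g (t, r) = r * k (t, r) := by
  have h1 : ContDiff ℝ (⊤ : ℕ∞) (fderiv ℝ g) := hg.fderiv_right (by simp)
  set f : (ℝ × ℝ) × ℝ → ℝ := fun q => fderiv ℝ g (q.1.1, q.2 * q.1.2) (0, 1) with hf
  have hfs : ContDiff ℝ (⊤ : ℕ∞) f := by
    refine ContDiff.clm_apply (h1.comp ?_) contDiff_const
    fun_prop
  refine ⟨fun x => ∫ s in (0:ℝ)..1, f (x, s), ?_, fun t r => ?_⟩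
  · rw [contDiff_infty]
    exact fun n => aux_param n ℝ f hfs
  · have hfc := hfs.continuous
    have hd : ∀ s ∈ uIcc (0:ℝ) 1, HasDerivAt (fun s => g (t, s * r)) (r * f ((t, r), s)) s := by
      intro s _
      have h2 : HasFDerivAt g (fderiv ℝ g (t, s * r)) (t, s * r) :=
        (hg.differentiable (by simp)).differentiableAt.hasFDerivAt
      have h3 : HasDerivAt (fun s : ℝ => (t, s * r)) ((0:ℝ), r) s := by
        refine (hasDerivAt_const s t).prodMk ?_
        simpa using (hasDerivAt_id s).mul_const r
      have h4 := h2.comp_hasDerivAt s h3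
      have h5 : ((0:ℝ), r) = r • ((0:ℝ), (1:ℝ)) := by simp
      rw [h5, map_smul, smul_eq_mul] at h4
      exact h4
    have := intervalIntegral.integral_eq_sub_of_hasDerivAt hd
      (Continuous.intervalIntegrable (by fun_prop) _ _)
    simp only [one_mul, zero_mul, h0, sub_zero] at this
    rw [← this, intervalIntegral.integral_const_mul]

lemma aux_fderiv_even (h : ℝ × ℝ → ℝ) (hh : ContDiff ℝ (⊤ : ℕ∞) h)
    (hev : ∀ t r, h (t, -r) = h (t, r)) (t r a b : ℝ) :
    fderiv ℝ h (t, -r) (a, -b) = fderiv ℝ h (t, r) (a, b) := by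
  set σ : ℝ × ℝ →L[ℝ] ℝ × ℝ := (ContinuousLinearMap.fst ℝ ℝ ℝ).prod
    (-(ContinuousLinearMap.snd ℝ ℝ ℝ)) with hσ
  have e : h ∘ σ = h := by
    ext ⟨t, r⟩
    simp [hσ, hev]
  have h2 : HasFDerivAt h (fderiv ℝ h (t, -r)) (σ (t, r)) :=
    (hh.differentiable (by simp)).differentiableAt.hasFDerivAt
  have h3 := h2.comp (t, r) σ.hasFDerivAt
  rw [e] at h3
  rw [h3.fderiv]
  simp [hσ]

lemma aux_radial (n : ℕ) : ∀ h : ℝ × ℝ → ℝ, ContDiff ℝ (⊤ : ℕ∞) h →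
    (∀ t r, h (t, -r) = h (t, r)) →
    ContDiff ℝ n (fun y : ℝ × ℝ => h (y.1, √(y.1 ^ 2 + y.2 ^ 2))) := by
  induction n with
  | zero =>
    intro h hh _
    have := hh.continuous
    rw [Nat.cast_zero, contDiff_zero]
    fun_prop
  | succ n ih =>
    intro h hh hev
    have h1 : ContDiff ℝ (⊤ : ℕ∞) (fderiv ℝ h) := hh.fderiv_right (by simp)
    have hodd : ∀ t r, fderiv ℝ h (t, -r) (0, 1) = - fderiv ℝ h (t, r) (0, 1) := by
      intro t r
      have := aux_fderiv_even h hh hev t r 0 (-1)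
      rw [neg_neg] at this
      rw [this, ← map_neg]; simp
    obtain ⟨k, hk, hkr⟩ := aux_hadamard (fun p => fderiv ℝ h p (0, 1))
      (h1.clm_apply contDiff_const) (fun t => by
        have := hodd t 0
        simp only [neg_zero] at this
        linarith)
    have hkev : ∀ t r, k (t, -r) = k (t, r) := by
      intro t r
      rcases eq_or_ne r 0 with rfl | hr
      · simp
      · have := hodd t r
        rw [hkr, hkr] at this
        have h5 : r * (k (t, -r) - k (t, r)) = 0 := by linarith
        rcases mul_eq_zero.1 h5 with h5 | h5
        · exact absurd h5 hr
        · linarith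
    have hht : ContDiff ℝ (⊤ : ℕ∞) (fun p => fderiv ℝ h p (1, 0)) :=
      h1.clm_apply contDiff_const
    have hhtev : ∀ t r, (fun p => fderiv ℝ h p (1, 0)) (t, -r) =
        (fun p => fderiv ℝ h p (1, 0)) (t, r) := by
      intro t r
      simpa using aux_fderiv_even h hh hev t r 1 0
    have i1 := ih _ hht hhtev
    have i2 := ih k hk hkev
    push_cast
    rw [contDiff_succ_iff_hasFDerivAt]
    refine ⟨fun y => (fderiv ℝ h (y.1, √(y.1 ^ 2 + y.2 ^ 2)) (1, 0)) •
      ContinuousLinearMap.fst ℝ ℝ ℝ + (k (y.1, √(y.1 ^ 2 + y.2 ^ 2))) •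
      (y.1 • ContinuousLinearMap.fst ℝ ℝ ℝ + y.2 • ContinuousLinearMap.snd ℝ ℝ ℝ), ?_, ?_⟩
    · refine (i1.smul contDiff_const).add (i2.smul ?_)
      fun_prop
    · rintro ⟨y₁, y₂⟩
      have h2 : HasFDerivAt h (fderiv ℝ h (y₁, √(y₁ ^ 2 + y₂ ^ 2))) (y₁, √(y₁ ^ 2 + y₂ ^ 2)) :=
        (hh.differentiable (by simp)).differentiableAt.hasFDerivAt
      have hsplit : ∀ p a b, fderiv ℝ h p (a, b) = a * fderiv ℝ h p (1, 0)
          + b * fderiv ℝ h p (0, 1) := by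
        intro p a b
        have : (a, b) = a • ((1:ℝ), (0:ℝ)) + b • ((0:ℝ), (1:ℝ)) := by simp
        rw [this, map_add, map_smul, map_smul, smul_eq_mul, smul_eq_mul]
      by_cases hy : y₁ ^ 2 + y₂ ^ 2 = 0
      · have e1 : y₁ = 0 := by nlinarith [sq_nonneg y₁, sq_nonneg y₂]
        have e2 : y₂ = 0 := by nlinarith [sq_nonneg y₁, sq_nonneg y₂]
        subst e1 e2
        simp only [ne_eq, OfNat.ofNat_ne_zero, not_false_eq_true, zero_pow, add_zero,
          Real.sqrt_zero, zero_smul, smul_zero] at h2 ⊢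
        rw [hasFDerivAt_iff_isLittleO] at h2 ⊢
        have ht : Filter.Tendsto (fun y : ℝ × ℝ => (y.1, √(y.1 ^ 2 + y.2 ^ 2))) (nhds (0, 0))
            (nhds (0, 0)) := by
          have : Continuous (fun y : ℝ × ℝ => (y.1, √(y.1 ^ 2 + y.2 ^ 2))) := by fun_prop
          have := this.tendsto (0, 0)
          simpa using this
        have h3 := h2.comp_tendsto ht
        have h4 : ((fun x' : ℝ × ℝ => x' - (0, 0)) ∘
            (fun y : ℝ × ℝ => (y.1, √(y.1 ^ 2 + y.2 ^ 2)))) =O[nhds (0, 0)]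
            (fun x' : ℝ × ℝ => x' - (0, 0)) := by
          refine Asymptotics.IsBigO.of_bound 2 (Filter.Eventually.of_forall fun y => ?_)
          obtain ⟨a, b⟩ := y
          have ha : |a| ≤ max |a| |b| := le_max_left _ _
          have hb : |b| ≤ max |a| |b| := le_max_right _ _
          have hs : √(a ^ 2 + b ^ 2) ≤ |a| + |b| := by
            rw [Real.sqrt_le_left (by positivity)]
            nlinarith [sq_abs a, sq_abs b, abs_nonneg a, abs_nonneg b,
              mul_nonneg (abs_nonneg a) (abs_nonneg b)]
          simp only [Function.comp, Prod.mk_zero_zero, sub_zero, Prod.norm_def, Real.norm_eq_abs,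
            abs_of_nonneg (Real.sqrt_nonneg _)]
          refine max_le (by linarith [abs_nonneg a]) (by linarith)
        refine (h3.trans_isBigO h4).congr_left fun y => ?_
        obtain ⟨a, b⟩ := y
        have h0 : fderiv ℝ h (0, 0) (0, 1) = 0 := by simpa using hkr 0 0
        simp only [Function.comp, Prod.mk_sub_mk, sub_zero]
        rw [hsplit (0, 0) a, h0]
        simp [mul_comm]
      · have hs : HasFDerivAt (fun y : ℝ × ℝ => y.1 ^ 2 + y.2 ^ 2)
            ((2 * y₁) • ContinuousLinearMap.fst ℝ ℝ ℝ + (2 * y₂) • ContinuousLinearMap.snd ℝ ℝ ℝ)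
            (y₁, y₂) := by
          have a1 := (hasFDerivAt_fst (𝕜 := ℝ) (p := (y₁, y₂))).pow 2
          have a2 := (hasFDerivAt_snd (𝕜 := ℝ) (p := (y₁, y₂))).pow 2
          refine (a1.add a2).congr_fderiv ?_
          simp
        have hs2 := hs.sqrt hy
        have hs3 := (hasFDerivAt_fst (𝕜 := ℝ) (p := (y₁, y₂))).prodMk hs2
        have h3 := h2.comp (y₁, y₂) hs3
        have hne : √(y₁ ^ 2 + y₂ ^ 2) ≠ 0 := by
          rw [Real.sqrt_ne_zero']
          exact lt_of_le_of_ne (by positivity) (Ne.symm hy)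
        refine h3.congr_fderiv (ContinuousLinearMap.ext ?_)
        rintro ⟨a, b⟩
        simp only [ContinuousLinearMap.comp_apply, ContinuousLinearMap.prod_apply]
        rw [hsplit, hkr]
        simp
        field_simp

lemma aux_iter (ψ : ℝ → ℝ) (hψ : ContDiff ℝ (⊤ : ℕ∞) ψ) (n : ℕ) :
    iteratedDeriv (n + 1) (fun x => x * ψ x) =
      fun x => x * iteratedDeriv (n + 1) ψ x + (n + 1) * iteratedDeriv n ψ x := by
  have hd : ∀ m x, HasDerivAt (iteratedDeriv m ψ) (iteratedDeriv (m + 1) ψ x) x := by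
    intro m x
    rw [iteratedDeriv_succ]
    exact ((hψ.differentiable_iteratedDeriv m (by exact_mod_cast WithTop.coe_lt_top _)) x).hasDerivAt
  induction n with
  | zero =>
    ext x
    rw [zero_add, iteratedDeriv_one]
    have h0 := hd 0 x
    simp only [iteratedDeriv_zero, zero_add] at h0
    have := (hasDerivAt_id x).mul h0
    simp only [id] at this
    rw [show (fun x => x * ψ x) = id * ψ from rfl, this.deriv]
    simp
    ring
  | succ n ih =>
    ext x
    rw [iteratedDeriv_succ, ih]
    have := ((hasDerivAt_id x).mul (hd (n + 1) x)).add ((hd n x).const_mul ((n : ℝ) + 1))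
    refine (HasDerivAt.deriv (HasDerivAt.congr_deriv this ?_))
    push_cast
    simp only [id]
    ring

lemma aux_even_quot (φ : ℝ → ℝ) (hφ : ContDiff ℝ (⊤ : ℕ∞) φ) (hev : ∀ x, φ (-x) = φ x) :
    ∃ ψ : ℝ → ℝ, ContDiff ℝ (⊤ : ℕ∞) ψ ∧ (∀ x, ψ (-x) = ψ x) ∧
      (∀ x, HasDerivAt φ (2 * x * ψ x) x) ∧
      ∀ l : ℕ, iteratedDeriv (2 * (l + 1)) φ 0 = 2 * (2 * l + 1) * iteratedDeriv (2 * l) ψ 0 := by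
  have hd : ∀ x, HasDerivAt φ (deriv φ x) x := fun x =>
    ((hφ.differentiable (by simp)) x).hasDerivAt
  have hodd : ∀ x, deriv φ (-x) = - deriv φ x := by
    intro x
    have h1 := (hd (-x)).comp x (hasDerivAt_neg x)
    have h2 : φ ∘ Neg.neg = φ := by ext x; simp [hev]
    have h3 : HasDerivAt φ (deriv φ (-x) * -1) x := by rwa [h2] at h1
    rw [h3.deriv]; ring
  have hs : ContDiff ℝ (⊤ : ℕ∞) (deriv φ) := by
    have : ContDiff ℝ ((⊤ : ℕ∞) + 1) φ := by simpa using hφ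
    exact (contDiff_succ_iff_deriv.1 this).2.2
  obtain ⟨k, hk, hkr⟩ := aux_hadamard (fun p => deriv φ p.2) (hs.comp contDiff_snd)
    (fun t => by have := hodd 0; simp only [neg_zero] at this; simp only; linarith)
  have hψs : ContDiff ℝ (⊤ : ℕ∞) (fun r => k (0, r) / 2) := by
    refine ContDiff.div_const (hk.comp ?_) 2
    fun_prop
  have hdψ : deriv φ = fun x => 2 * (x * (k (0, x) / 2)) := by
    ext x
    have := hkr 0 x
    simp only at this
    rw [this]; ring
  refine ⟨fun r => k (0, r) / 2, hψs, ?_, ?_, ?_⟩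
  · intro r
    rcases eq_or_ne r 0 with rfl | hr
    · simp
    · have := hodd r
      rw [hdψ] at this
      simp only at this
      have h5 : r * (k (0, -r) - k (0, r)) = 0 := by linarith
      rcases mul_eq_zero.1 h5 with h5 | h5
      · exact absurd h5 hr
      · simp only; linarith
  · intro x
    refine (hd x).congr_deriv ?_
    rw [hdψ]; ring
  · intro l
    rw [show 2 * (l + 1) = (2 * l + 1) + 1 by ring, iteratedDeriv_succ', hdψ,
      iteratedDeriv_const_mul_field, aux_iter _ hψs]
    push_cast
    ring

lemma aux_glue (n : ℕ) : ∀ φ₁ φ₂ : ℝ → ℝ, ContDiff ℝ (⊤ : ℕ∞) φ₁ → ContDiff ℝ (⊤ : ℕ∞) φ₂ →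
    (∀ x, φ₁ (-x) = φ₁ x) → (∀ x, φ₂ (-x) = φ₂ x) →
    (∀ l : ℕ, iteratedDeriv (2 * l) φ₁ 0 = (-1 : ℝ) ^ l * iteratedDeriv (2 * l) φ₂ 0) →
    ContDiff ℝ n (fun t => if 0 ≤ t then φ₁ √t else φ₂ √(-t)) := by
  have hcont : ∀ φ₁ φ₂ : ℝ → ℝ, Continuous φ₁ → Continuous φ₂ → φ₁ 0 = φ₂ 0 →
      Continuous (fun t => if 0 ≤ t then φ₁ √t else φ₂ √(-t)) := by
    intro φ₁ φ₂ h1 h2 h0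
    refine Continuous.if_le (by fun_prop) (by fun_prop) continuous_const continuous_id ?_
    intro x hx
    subst hx
    simpa using h0
  induction n with
  | zero =>
    intro φ₁ φ₂ h1 h2 _ _ h0
    rw [Nat.cast_zero, contDiff_zero]
    exact hcont _ _ h1.continuous h2.continuous (by simpa using h0 0)
  | succ n ih =>
    intro φ₁ φ₂ h1 h2 e1 e2 h0
    obtain ⟨ψ₁, s1, ev1, d1, j1⟩ := aux_even_quot φ₁ h1 e1
    obtain ⟨ψ₂, s2, ev2, d2, j2⟩ := aux_even_quot φ₂ h2 e2
    have hj : ∀ l : ℕ, iteratedDeriv (2 * l) ψ₁ 0 =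
        (-1 : ℝ) ^ l * iteratedDeriv (2 * l) (fun x => - ψ₂ x) 0 := by
      intro l
      have := h0 (l + 1)
      rw [j1, j2, pow_succ] at this
      have hp : (2 * (2 * (l:ℝ) + 1)) ≠ 0 := by positivity
      apply mul_left_cancel₀ hp
      rw [this, show (fun x => - ψ₂ x) = -ψ₂ from rfl, iteratedDeriv_neg]
      ring
    have hI := ih ψ₁ (fun x => - ψ₂ x) s1 s2.neg ev1 (fun x => by simp [ev2]) hj
    have hder : ∀ t, HasDerivAt (fun t => if 0 ≤ t then φ₁ √t else φ₂ √(-t))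
        ((fun t => if 0 ≤ t then ψ₁ √t else - ψ₂ √(-t)) t) t := by
      apply hasDerivAt_of_hasDerivAt_of_ne' (x := 0)
      · intro t ht
        rcases lt_or_gt_of_ne ht with ht | ht
        · have hne : √(-t) ≠ 0 := by rw [Real.sqrt_ne_zero']; linarith
          have a1 : HasDerivAt (fun t => φ₂ √(-t)) (- ψ₂ √(-t)) t := by
            have := (d2 √(-t)).comp t (((hasDerivAt_neg t).sqrt (by linarith)))
            refine this.congr_deriv ?_
            field_simp
          simp only [not_le.2 ht, if_false]
          refine a1.congr_of_eventuallyEq ?_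
          filter_upwards [Iio_mem_nhds ht] with x hx
          simp [not_le.2 (show x < 0 from hx)]
        · have hne : √t ≠ 0 := by rw [Real.sqrt_ne_zero']; linarith
          have a1 : HasDerivAt (fun t => φ₁ √t) (ψ₁ √t) t := by
            have := (d1 √t).comp t (((hasDerivAt_id t).sqrt (by simp; linarith)))
            refine this.congr_deriv ?_
            simp only [id]
            field_simp
          simp only [ht.le, if_true]
          refine a1.congr_of_eventuallyEq ?_
          filter_upwards [Ioi_mem_nhds ht] with x hx
          simp [le_of_lt (show 0 < x from hx)]
      · exact (hcont _ _ h1.continuous h2.continuous (by simpa using h0 0)).continuousAt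
      · exact hI.continuous.continuousAt
    push_cast
    rw [contDiff_succ_iff_deriv]
    refine ⟨fun t => (hder t).differentiableAt, by simp, ?_⟩
    have : deriv (fun t => if 0 ≤ t then φ₁ √t else φ₂ √(-t)) =
      (fun t => if 0 ≤ t then ψ₁ √t else - ψ₂ √(-t)) := funext fun t => (hder t).deriv
    rw [this]
    exact hI

lemma aux_global (φ₁ φ₂ : ℝ → ℝ) (h1 : ContDiff ℝ (⊤ : ℕ∞) φ₁) (h2 : ContDiff ℝ (⊤ : ℕ∞) φ₂)
    (e1 : ∀ x, φ₁ (-x) = φ₁ x) (e2 : ∀ x, φ₂ (-x) = φ₂ x)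
    (h0 : ∀ l : ℕ, iteratedDeriv (2 * l) φ₁ 0 = (-1 : ℝ) ^ l * iteratedDeriv (2 * l) φ₂ 0) :
    ∃ G : ℝ × ℝ → ℝ, ContDiff ℝ (⊤ : ℕ∞) G ∧ ∀ x₁ x₂ : ℝ, 0 < x₁ ^ 2 + x₂ ^ 2 →
      (φ₁ x₁ - φ₂ x₂) / (x₁ ^ 2 + x₂ ^ 2) = G (x₁ ^ 2 - x₂ ^ 2, 2 * x₁ * x₂) := by
  set F : ℝ → ℝ := fun t => if 0 ≤ t then φ₁ √t else φ₂ √(-t) with hF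
  have hFs : ContDiff ℝ (⊤ : ℕ∞) F := by
    rw [contDiff_infty]
    exact fun n => aux_glue n φ₁ φ₂ h1 h2 e1 e2 h0
  have hF1 : ∀ x, F (x ^ 2) = φ₁ x := by
    intro x
    simp only [hF, sq_nonneg, if_true, Real.sqrt_sq_eq_abs]
    rcases abs_choice x with h | h <;> rw [h]
    exact e1 x
  have hF2 : ∀ x, F (-x ^ 2) = φ₂ x := by
    intro x
    rcases eq_or_ne x 0 with rfl | hx
    · have := h0 0
      simp at this
      simp [hF, this]
    · have : ¬ (0 ≤ -x ^ 2) := by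
        have : 0 < x ^ 2 := by positivity
        linarith
      simp only [hF, this, if_false, neg_neg, Real.sqrt_sq_eq_abs]
      rcases abs_choice x with h | h <;> rw [h]
      exact e2 x
  obtain ⟨k, hk, hkr⟩ := aux_hadamard (fun p => F ((p.1 + p.2) / 2) - F ((p.1 - p.2) / 2))
    (by fun_prop) (by simp)
  have hkev : ∀ t r, k (t, -r) = k (t, r) := by
    intro t r
    rcases eq_or_ne r 0 with rfl | hr
    · simp
    · have a1 := hkr t r
      have a2 := hkr t (-r)
      simp only [← sub_eq_add_neg, sub_neg_eq_add] at a1 a2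
      have h5 : r * (k (t, -r) - k (t, r)) = 0 := by linarith
      rcases mul_eq_zero.1 h5 with h5 | h5
      · exact absurd h5 hr
      · linarith
  refine ⟨fun y => k (y.1, √(y.1 ^ 2 + y.2 ^ 2)), ?_, ?_⟩
  · rw [contDiff_infty]
    exact fun n => aux_radial n k hk hkev
  · intro x₁ x₂ hx
    have hr : √((x₁ ^ 2 - x₂ ^ 2) ^ 2 + (2 * x₁ * x₂) ^ 2) = x₁ ^ 2 + x₂ ^ 2 := by
      rw [show (x₁ ^ 2 - x₂ ^ 2) ^ 2 + (2 * x₁ * x₂) ^ 2 = (x₁ ^ 2 + x₂ ^ 2) ^ 2 by ring]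
      exact Real.sqrt_sq hx.le
    simp only [hr]
    have := hkr (x₁ ^ 2 - x₂ ^ 2) (x₁ ^ 2 + x₂ ^ 2)
    simp only at this
    rw [show (x₁ ^ 2 - x₂ ^ 2 + (x₁ ^ 2 + x₂ ^ 2)) / 2 = x₁ ^ 2 by ring,
      show (x₁ ^ 2 - x₂ ^ 2 - (x₁ ^ 2 + x₂ ^ 2)) / 2 = -x₂ ^ 2 by ring, hF1, hF2] at this
    rw [this]
    field_simp

lemma aux_cutoff (a : ℝ) (ha : 0 < a) (φ : ℝ → ℝ) (hφ : ContDiffOn ℝ (⊤ : ℕ∞) φ (Ioo (-a) a))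
    (hev : ∀ x ∈ Ioo (-a) a, φ (-x) = φ x) :
    ∃ f : ℝ → ℝ, ContDiff ℝ (⊤ : ℕ∞) f ∧ (∀ x, f (-x) = f x) ∧ (∀ x, |x| < a / 3 → f x = φ x) ∧
      ∀ n, iteratedDeriv n f 0 = iteratedDerivWithin n φ (Ioo (-a) a) 0 := by
  let χ : ContDiffBump (0 : ℝ) := ⟨a / 3, a / 2, by linarith, by linarith⟩
  have hz : ∀ x, a / 2 ≤ |x| → χ x = 0 := fun x hx => χ.zero_of_le_dist (by simpa using hx)
  have hone : ∀ x, |x| < a / 3 → χ x * φ x = φ x := by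
    intro x hx
    rw [χ.one_of_mem_closedBall (by simpa using hx.le), one_mul]
  refine ⟨fun x => χ x * φ x, ?_, ?_, hone, ?_⟩
  · rw [contDiff_iff_contDiffAt]
    intro x
    by_cases hx : x ∈ Ioo (-a) a
    · exact χ.contDiffAt.mul (hφ.contDiffAt (isOpen_Ioo.mem_nhds hx))
    · have : (fun x => χ x * φ x) =ᶠ[nhds x] fun _ => 0 := by
        have hx' : a / 2 < |x| := by
          by_contra! h
          exact hx (by rw [mem_Ioo, ← abs_lt]; linarith)
        have : {y : ℝ | a / 2 < |y|} ∈ nhds x :=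
          (isOpen_lt continuous_const continuous_abs).mem_nhds hx'
        filter_upwards [this] with y hy
        rw [hz y (le_of_lt hy), zero_mul]
      exact contDiffAt_const.congr_of_eventuallyEq this
  · intro x
    simp only [χ.neg]
    by_cases hx : x ∈ Ioo (-a) a
    · rw [hev x hx]
    · have hx' : a / 2 ≤ |x| := by
        by_contra! h
        exact hx (by rw [mem_Ioo, ← abs_lt]; linarith)
      rw [hz x hx']; simp
  · intro n
    rw [iteratedDerivWithin_of_isOpen isOpen_Ioo (by simp [ha])]
    refine Filter.EventuallyEq.iteratedDeriv_eq n ?_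
    have : {y : ℝ | |y| < a / 3} ∈ nhds (0:ℝ) :=
      (isOpen_lt continuous_abs continuous_const).mem_nhds (by simp; linarith)
    filter_upwards [this] with y hy using hone y hy

noncomputable def auxQ : (n : ℕ) → (ContinuousMultilinearMap ℝ (fun _ : Fin n => ℝ × ℝ) ℝ)
  | 0 => ContinuousMultilinearMap.constOfIsEmpty ℝ (fun _ : Fin 0 => ℝ × ℝ) 1
  | 1 => ((ContinuousLinearMap.fst ℝ ℝ ℝ).smulRight (auxQ 0)).uncurryLeft
  | (n + 2) => ((ContinuousLinearMap.fst ℝ ℝ ℝ).smulRight (auxQ (n + 1))).uncurryLeft +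
      (1 / 4 : ℝ) • ((ContinuousLinearMap.snd ℝ ℝ ℝ).smulRight
        (((ContinuousLinearMap.snd ℝ ℝ ℝ).smulRight (auxQ n)).uncurryLeft)).uncurryLeft

lemma auxQ_norm (n : ℕ) : ‖auxQ n‖ ≤ 2 ^ n ∧ ‖auxQ (n + 1)‖ ≤ 2 ^ (n + 1) := by
  have key : ∀ (L : ℝ × ℝ →L[ℝ] ℝ), ‖L‖ ≤ 1 → ∀ (m : ℕ)
      (q : ContinuousMultilinearMap ℝ (fun _ : Fin m => ℝ × ℝ) ℝ),
      ‖ContinuousLinearMap.uncurryLeft (Ei := fun _ : Fin (m + 1) => ℝ × ℝ)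
        (L.smulRight q)‖ ≤ ‖q‖ := by
    intro L hL m q
    rw [ContinuousLinearMap.uncurryLeft_norm, ContinuousLinearMap.norm_smulRight_apply]
    nlinarith [norm_nonneg q]
  have hf := ContinuousLinearMap.norm_fst_le ℝ ℝ ℝ
  have hs := ContinuousLinearMap.norm_snd_le ℝ ℝ ℝ
  have h0 : ‖auxQ 0‖ ≤ 1 := by
    rw [auxQ, ContinuousMultilinearMap.norm_constOfIsEmpty]
    simp
  induction n with
  | zero =>
    refine ⟨by simpa using h0, ?_⟩
    have := key _ hf 0 (auxQ 0)
    change ‖auxQ 1‖ ≤ _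
    rw [auxQ]
    refine this.trans (h0.trans (by norm_num))
  | succ n ih =>
    refine ⟨ih.2, ?_⟩
    change ‖auxQ (n + 2)‖ ≤ _
    rw [auxQ]
    have b1 := key _ hf _ (auxQ (n + 1))
    have b2 := key _ hs _ (auxQ n)
    have b3 := (key _ hs _ (ContinuousLinearMap.uncurryLeft (Ei := fun _ : Fin (n + 1) => ℝ × ℝ)
        ((ContinuousLinearMap.snd ℝ ℝ ℝ).smulRight (auxQ n)))).trans b2
    refine (norm_add_le _ _).trans ?_
    rw [norm_smul]
    have h4 : ‖(1 / 4 : ℝ)‖ = 1 / 4 := by norm_num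
    rw [h4]
    have p : (0:ℝ) < 2 ^ n := by positivity
    have i1 := ih.1
    have i2 := ih.2
    have e : (2:ℝ) ^ (n + 1 + 1) = 4 * 2 ^ n := by ring
    have e' : (2:ℝ) ^ (n + 1) = 2 * 2 ^ n := by ring
    rw [e]
    rw [e'] at i2
    linarith

lemma auxQ_apply (u v y : ℝ) (h : y ^ 2 / 4 = - (u * v)) (n : ℕ) :
    (u - v) * auxQ n (fun _ => (u + v, y)) = u ^ (n + 1) - v ^ (n + 1) ∧
    (u - v) * auxQ (n + 1) (fun _ => (u + v, y)) = u ^ (n + 2) - v ^ (n + 2) := by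
  induction n with
  | zero =>
    constructor
    · simp [auxQ]
    · simp [auxQ]
      ring
  | succ n ih =>
    refine ⟨ih.2, ?_⟩
    obtain ⟨i1, i2⟩ := ih
    have : auxQ (n + 1 + 1) (fun _ => (u + v, y)) = (u + v) * auxQ (n + 1) (fun _ => (u + v, y))
        + y ^ 2 / 4 * auxQ n (fun _ => (u + v, y)) := by
      rw [auxQ]
      simp [Fin.tail_def]
      ring
    rw [this, h, mul_add, mul_left_comm, i2,
      show (u - v) * (-(u * v) * auxQ n (fun _ => (u + v, y))) =
        -(u * v) * ((u - v) * auxQ n (fun _ => (u + v, y))) by ring, i1]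
    ring

lemma aux_an_series (a : ℝ) (ha : 0 < a) (φ : ℝ → ℝ) (hφ : AnalyticOnNhd ℝ φ (Ioo (-a) a))
    (hev : ∀ x ∈ Ioo (-a) a, φ (-x) = φ x) :
    ∃ δ > 0, ∃ C R : ℝ, 0 < C ∧ 0 < R ∧
      (∀ n, |iteratedDerivWithin n φ (Ioo (-a) a) 0 / n.factorial| ≤ C * R ^ n) ∧
      ∀ x, |x| < δ → HasSum (fun n : ℕ =>
        iteratedDerivWithin (2 * n) φ (Ioo (-a) a) 0 / (2 * n).factorial * x ^ (2 * n)) (φ x) := by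
  have h0 : (0:ℝ) ∈ Ioo (-a) a := by simp [ha]
  obtain ⟨p, r, hp⟩ := hφ 0 h0
  obtain ⟨C, R, hC, hR, hb⟩ := p.le_mul_pow_of_radius_pos (hp.r_pos.trans_le hp.r_le)
  have hc : ∀ n, p.coeff n = iteratedDerivWithin n φ (Ioo (-a) a) 0 / n.factorial := by
    intro n
    rw [iteratedDerivWithin_of_isOpen isOpen_Ioo h0, iteratedDeriv_eq_iteratedFDeriv,
      ← hp.factorial_smul 1 n, eq_div_iff (by positivity)]
    simp [mul_comm]
  obtain ⟨ρ, hρ0, hρ⟩ := ENNReal.lt_iff_exists_nnreal_btwn.1 hp.r_pos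
  have hρ0' : (0:ℝ) < ρ := by exact_mod_cast hρ0
  refine ⟨min ρ a, by positivity, C, R, hC, hR, ?_, ?_⟩
  · intro n
    rw [← hc, ← Real.norm_eq_abs]
    refine le_trans ?_ (hb n)
    rw [FormalMultilinearSeries.norm_apply_eq_norm_coef]
  · intro x hx
    have hS : ∀ z : ℝ, |z| < ρ → HasSum (fun n => p.coeff n * z ^ n) (φ z) := by
      intro z hz
      have hz' : z ∈ Metric.eball (0:ℝ) r := by
        refine Metric.eball_subset_eball hρ.le ?_
        rw [Metric.eball_coe]
        simpa using hz
      have := hp.hasSum hz'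
      simp only [zero_add, FormalMultilinearSeries.apply_eq_pow_smul_coeff, smul_eq_mul] at this
      simpa [mul_comm] using this
    have hxρ := hx.trans_le (min_le_left _ _)
    have hxa : x ∈ Ioo (-a) a := by
      rw [mem_Ioo, ← abs_lt]; exact hx.trans_le (min_le_right _ _)
    have s1 := hS x hxρ
    have s2 := hS (-x) (by rwa [abs_neg])
    rw [hev x hxa] at s2
    have s3 := (s1.add s2).div_const 2
    rw [add_self_div_two] at s3
    have hinj : Function.Injective (fun n : ℕ => 2 * n) := fun a b h => by simpa using h
    rw [← hinj.hasSum_iff] at s3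
    · have hfun : ((fun i => (p.coeff i * x ^ i + p.coeff i * (-x) ^ i) / 2) ∘ fun n => 2 * n) =
          (fun n : ℕ => iteratedDerivWithin (2 * n) φ (Ioo (-a) a) 0 / (2 * n).factorial *
            x ^ (2 * n)) := by
        funext n
        simp only [Function.comp]
        rw [← hc, (even_two_mul n).neg_pow]
        ring
      rw [hfun] at s3
      exact s3
    · intro n hn
      have : Odd n := by
        rw [← Nat.not_even_iff_odd]
        rintro ⟨m, rfl⟩
        exact hn ⟨m, by ring⟩
      rw [this.neg_pow]
      ring

lemma aux_analytic (a : ℝ) (ha : 0 < a) (φ₁ φ₂ : ℝ → ℝ)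
    (heven₁ : ∀ x ∈ Ioo (-a) a, φ₁ (-x) = φ₁ x)
    (heven₂ : ∀ x ∈ Ioo (-a) a, φ₂ (-x) = φ₂ x)
    (hder : ∀ l : ℕ,
      iteratedDerivWithin (2 * l) φ₁ (Ioo (-a) a) 0 =
        (-1 : ℝ) ^ l * iteratedDerivWithin (2 * l) φ₂ (Ioo (-a) a) 0)
    (h1 : AnalyticOnNhd ℝ φ₁ (Ioo (-a) a)) (h2 : AnalyticOnNhd ℝ φ₂ (Ioo (-a) a)) :
      ∃ ε > 0, ∃ V : Set (ℝ × ℝ), IsOpen V ∧ (0, 0) ∈ V ∧ ∃ G : ℝ × ℝ → ℝ,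
        AnalyticOnNhd ℝ G V ∧
        ∀ x₁ x₂ : ℝ, 0 < x₁ ^ 2 + x₂ ^ 2 → x₁ ^ 2 + x₂ ^ 2 < ε →
          (x₁ ^ 2 - x₂ ^ 2, 2 * x₁ * x₂) ∈ V ∧
          (φ₁ x₁ - φ₂ x₂) / (x₁ ^ 2 + x₂ ^ 2) = G (x₁ ^ 2 - x₂ ^ 2, 2 * x₁ * x₂) := by
  obtain ⟨δ₁, hδ₁, C, R, hC, hR, hb, hs1⟩ := aux_an_series a ha φ₁ h1 heven₁
  obtain ⟨δ₂, hδ₂, _, _, _, _, _, hs2⟩ := aux_an_series a ha φ₂ h2 heven₂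
  set c : ℕ → ℝ := fun n => iteratedDerivWithin (2 * n) φ₁ (Ioo (-a) a) 0 / (2 * n).factorial
    with hc
  have hcb : ∀ n, |c n| ≤ C * R ^ (2 * n) := fun n => hb (2 * n)
  have t1 : ∀ x, |x| < δ₁ → HasSum (fun n => c n * (x ^ 2) ^ n) (φ₁ x) := by
    intro x hx
    simpa only [hc, pow_mul] using hs1 x hx
  have t2 : ∀ x, |x| < δ₂ → HasSum (fun n => c n * (-x ^ 2) ^ n) (φ₂ x) := by
    intro x hx
    have := hs2 x hx
    convert this using 2 with n
    rw [hc]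
    simp only [hder]
    rw [neg_pow, pow_mul]
    have : ((-1 : ℝ) ^ n) * (-1) ^ n = 1 := by rw [← mul_pow]; simp
    linear_combination (iteratedDerivWithin (2 * n) φ₂ (Ioo (-a) a) 0 / (2 * n).factorial *
      (x ^ 2) ^ n) * this
  let p : FormalMultilinearSeries ℝ (ℝ × ℝ) ℝ := fun n => c (n + 1) • auxQ n
  let s : NNReal := ⟨1 / (2 * R ^ 2), by positivity⟩
  have hs0 : 0 < s := by
    rw [← NNReal.coe_pos]
    change 0 < 1 / (2 * R ^ 2)
    positivity
  have hrad : (s : ENNReal) ≤ p.radius := by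
    refine p.le_radius_of_bound (C * R ^ 2) fun n => ?_
    change ‖c (n + 1) • auxQ n‖ * (1 / (2 * R ^ 2)) ^ n ≤ _
    rw [norm_smul, Real.norm_eq_abs]
    calc |c (n + 1)| * ‖auxQ n‖ * (1 / (2 * R ^ 2)) ^ n
        ≤ (C * R ^ (2 * (n + 1))) * 2 ^ n * (1 / (2 * R ^ 2)) ^ n := by
          gcongr
          · exact hcb _
          · exact (auxQ_norm n).1
      _ = C * R ^ 2 := by
          rw [mul_add, pow_add, pow_mul, one_div, inv_pow, mul_pow]
          field_simp
  have hpr : 0 < p.radius := lt_of_lt_of_le (by exact_mod_cast hs0) hrad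
  have hG := p.hasFPowerSeriesOnBall hpr
  refine ⟨min (s / 2) (min (δ₁ ^ 2) (δ₂ ^ 2)), by positivity, Metric.ball 0 s, Metric.isOpen_ball,
    Metric.mem_ball_self (by exact_mod_cast hs0), p.sum, ?_, ?_⟩
  · refine hG.analyticOnNhd.mono ?_
    rw [← Metric.eball_coe]
    exact Metric.eball_subset_eball hrad
  · intro x₁ x₂ hx0 hx
    have hxs := hx.trans_le (min_le_left _ _)
    have hx1 := hx.trans_le ((min_le_right _ _).trans (min_le_left _ _))
    have hx2 := hx.trans_le ((min_le_right _ _).trans (min_le_right _ _))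
    have hs0' : (0:ℝ) < s := by exact_mod_cast hs0
    constructor
    · rw [mem_ball_zero_iff, Prod.norm_def, Real.norm_eq_abs, Real.norm_eq_abs]
      refine max_lt ?_ ?_ <;> rw [abs_lt] <;> constructor <;>
        nlinarith [sq_nonneg x₁, sq_nonneg x₂, sq_nonneg (x₁ - x₂), sq_nonneg (x₁ + x₂)]
    · have u1 := t1 x₁ (abs_lt_of_sq_lt_sq (by nlinarith [sq_nonneg x₂]) hδ₁.le)
      have u2 := t2 x₂ (abs_lt_of_sq_lt_sq (by nlinarith [sq_nonneg x₁]) hδ₂.le)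
      have u3 := (u1.sub u2).div_const (x₁ ^ 2 + x₂ ^ 2)
      rw [← hasSum_nat_add_iff' 1] at u3
      simp only [Finset.range_one, Finset.sum_singleton, pow_zero, sub_self, zero_div,
        sub_zero] at u3
      rw [FormalMultilinearSeries.sum, ← u3.tsum_eq]
      congr 1
      ext n
      change _ = c (n + 1) * auxQ n (fun _ => (x₁ ^ 2 - x₂ ^ 2, 2 * x₁ * x₂))
      have := (auxQ_apply (x₁ ^ 2) (-x₂ ^ 2) (2 * x₁ * x₂) (by ring) n).1
      rw [sub_neg_eq_add, ← sub_eq_add_neg] at this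
      rw [← mul_sub, ← this]
      field_simp

/-- if `φ₁, φ₂` are smooth even functions near `0` whose derivatives
satisfy `φ₁^{(2l)}(0) = (−1)^l φ₂^{(2l)}(0)`, then `(φ₁(x₁) − φ₂(x₂))/(x₁²+x₂²)`
is a smooth function of `(y₁,y₂) = (x₁²−x₂², 2x₁x₂)` near the origin; if `φ₁, φ₂`
are real analytic then it is real analytic in `(y₁,y₂)`. -/
theorem stmt_5 (a : ℝ) (ha : 0 < a) (φ₁ φ₂ : ℝ → ℝ)
    (hφ₁ : ContDiffOn ℝ (⊤ : ℕ∞) φ₁ (Ioo (-a) a)) (hφ₂ : ContDiffOn ℝ (⊤ : ℕ∞) φ₂ (Ioo (-a) a))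
    (heven₁ : ∀ x ∈ Ioo (-a) a, φ₁ (-x) = φ₁ x)
    (heven₂ : ∀ x ∈ Ioo (-a) a, φ₂ (-x) = φ₂ x)
    (hder : ∀ l : ℕ,
      iteratedDerivWithin (2 * l) φ₁ (Ioo (-a) a) 0 =
        (-1 : ℝ) ^ l * iteratedDerivWithin (2 * l) φ₂ (Ioo (-a) a) 0) :
    (∃ ε > 0, ∃ V : Set (ℝ × ℝ), IsOpen V ∧ (0, 0) ∈ V ∧ ∃ G : ℝ × ℝ → ℝ,
      ContDiffOn ℝ (⊤ : ℕ∞) G V ∧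
      ∀ x₁ x₂ : ℝ, 0 < x₁ ^ 2 + x₂ ^ 2 → x₁ ^ 2 + x₂ ^ 2 < ε →
        (x₁ ^ 2 - x₂ ^ 2, 2 * x₁ * x₂) ∈ V ∧
        (φ₁ x₁ - φ₂ x₂) / (x₁ ^ 2 + x₂ ^ 2) = G (x₁ ^ 2 - x₂ ^ 2, 2 * x₁ * x₂)) ∧
    (AnalyticOnNhd ℝ φ₁ (Ioo (-a) a) → AnalyticOnNhd ℝ φ₂ (Ioo (-a) a) →
      ∃ ε > 0, ∃ V : Set (ℝ × ℝ), IsOpen V ∧ (0, 0) ∈ V ∧ ∃ G : ℝ × ℝ → ℝ,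
        AnalyticOnNhd ℝ G V ∧
        ∀ x₁ x₂ : ℝ, 0 < x₁ ^ 2 + x₂ ^ 2 → x₁ ^ 2 + x₂ ^ 2 < ε →
          (x₁ ^ 2 - x₂ ^ 2, 2 * x₁ * x₂) ∈ V ∧
          (φ₁ x₁ - φ₂ x₂) / (x₁ ^ 2 + x₂ ^ 2) = G (x₁ ^ 2 - x₂ ^ 2, 2 * x₁ * x₂)) := by
  refine ⟨?_, fun h1 h2 => aux_analytic a ha φ₁ φ₂ heven₁ heven₂ hder h1 h2⟩
  obtain ⟨f₁, s1, e1, g1, j1⟩ := aux_cutoff a ha φ₁ hφ₁ heven₁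
  obtain ⟨f₂, s2, e2, g2, j2⟩ := aux_cutoff a ha φ₂ hφ₂ heven₂
  obtain ⟨G, hG, hGe⟩ := aux_global f₁ f₂ s1 s2 e1 e2 (fun l => by rw [j1, j2, hder])
  refine ⟨(a / 3) ^ 2, by positivity, univ, isOpen_univ, mem_univ _, G, hG.contDiffOn, ?_⟩
  intro x₁ x₂ hx0 hx
  refine ⟨mem_univ _, ?_⟩
  rw [← hGe x₁ x₂ hx0,
    g1 x₁ (abs_lt_of_sq_lt_sq (by nlinarith [sq_nonneg x₂]) (by positivity)),
    g2 x₂ (abs_lt_of_sq_lt_sq (by nlinarith [sq_nonneg x₁]) (by positivity))]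
end

section
/- Let ν₃ < 0 < ν₁ < ν₀ be real numbers. Suppose: ρ₁ is real analytic on (ν₁,ν₀) and there are real analytic functions G₁⁻, G₁⁺ on a neighborhood of 0 with ρ₁(x) = G₁⁻(√(x−ν₁))/√(x−ν₁) for x near ν₁ and ρ₁(x) = G₁⁺(√(ν₀−x))/√(ν₀−x) for x near ν₀; ρ₂ is real analytic on (0,ν₁) and there is a real analytic function G₂ on a neighborhood of 0 with ρ₂(x) = G₂(√x)/√x for x near 0; and there is a real analytic function G₃ on a neighborhood of the interval [0,√(−ν₃)] with ρ₃(x) = G₃(√(−x))/√(−x) for all x ∈ (ν₃,0). Then the three functions J₁(κ₁,κ₂) = ∫_{ν₁}^{ν₀} √((x−κ₁)(x−κ₂)) ρ₁(x) dx, J₂(κ₁,κ₂) = ∫_0^{κ₂} √((x−κ₁)(κ₂−x)) ρ₂(x) dx, and J₃(κ₁,κ₂) = ∫_{ν₃}^{κ₁} √((κ₁−x)(κ₂−x)) ρ₃(x) dx are real analytic functions of (κ₁,κ₂) on the open rectangle (ν₃,0) × (0,ν₁). -/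
open MeasureTheory Set

theorem aux_local {E : Type*} [NormedAddCommGroup E] [NormedSpace ℝ E]
    (F : E → ℝ) (z₀ : E) (hF : AnalyticAt ℝ F z₀) :
    ∃ ε > 0, ∀ (φ : ℝ → E) (A : Set ℝ) (w : ℝ → ℝ), Continuous φ → MeasurableSet A →
      (∀ t ∈ A, ‖φ t‖ < ε) → IntegrableOn w A →
      AnalyticAt ℝ (fun z => ∫ t in A, w t * F (z + φ t)) z₀ ∧
      ∀ᶠ z in nhds z₀, IntegrableOn (fun t => w t * F (z + φ t)) A := by
  obtain ⟨p, r, hp⟩ := hF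
  obtain ⟨ρ, hρ0, hρr⟩ : ∃ ρ : NNReal, 0 < ρ ∧ (ρ + ρ : ENNReal) < r := by
    obtain ⟨s, hs0, hs⟩ := ENNReal.lt_iff_exists_nnreal_btwn.1 hp.r_pos
    refine ⟨s / 2, ?_, ?_⟩
    · have : (0:NNReal) < s := by exact_mod_cast hs0
      exact half_pos this
    · rw [← ENNReal.coe_add, add_halves]; exact hs
  have hρp : (ρ + ρ : ENNReal) < p.radius := hρr.trans_le hp.r_le
  have hρ1 : (ρ : ENNReal) < p.radius := lt_of_le_of_lt le_self_add hρp
  set b : ℕ → NNReal := fun k => ∑' s : Σ l : ℕ, { s : Finset (Fin (k + l)) // s.card = l },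
    ‖p (k + s.1)‖₊ * ρ ^ s.1 with hb
  have hbs : Summable fun k => b k * ρ ^ k := by
    simpa only [hb, ← NNReal.tsum_mul_right] using
      (NNReal.summable_sigma.1 (p.changeOriginSeries_summable_aux₁ hρp)).2
  have hbs' : Summable fun k => (b k : ℝ) * (ρ:ℝ) ^ k := by exact_mod_cast hbs
  have hbound : ∀ x : E, ‖x‖ < ρ → ∀ k, ‖p.changeOrigin x k‖ ≤ b k := by
    intro x hx k
    have hx' : ‖x‖₊ < ρ := hx
    have h1 : (‖x‖₊ : ENNReal) < p.radius := lt_trans (by exact_mod_cast hx') hρ1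
    have := (p.nnnorm_changeOrigin_le k h1).trans (Summable.tsum_le_tsum (fun s => by
      gcongr) (p.changeOriginSeries_summable_aux₂ h1 k) (p.changeOriginSeries_summable_aux₂ hρ1 k))
    exact_mod_cast this
  refine ⟨ρ, by exact_mod_cast hρ0, ?_⟩
  intro φ A w hφ hA hφA hw
  have hmeas : ∀ k, AEStronglyMeasurable (fun t => p.changeOrigin (φ t) k)
      (volume.restrict A) := by
    intro k
    refine ContinuousOn.aestronglyMeasurable ?_ hA
    refine (p.hasFPowerSeriesOnBall_changeOrigin k hp.radius_pos).continuousOn.comp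
      hφ.continuousOn ?_
    intro t ht
    have : ‖φ t‖₊ < ρ := hφA t ht
    rw [mem_eball_zero_iff]
    exact lt_trans (by rw [enorm_eq_nnnorm]; exact_mod_cast this) hρ1
  have hae : ∀ k, ∀ᵐ t ∂(volume.restrict A), ‖p.changeOrigin (φ t) k‖ ≤ b k := by
    intro k
    filter_upwards [ae_restrict_mem hA] with t ht using hbound _ (hφA t ht) k
  have hitg : ∀ k, Integrable (fun t => w t • p.changeOrigin (φ t) k) (volume.restrict A) := by
    intro k
    exact hw.smul_bdd _ (hmeas k) (hae k)
  have hwn : Integrable (fun t => ‖w t‖) (volume.restrict A) := hw.norm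
  set W := ∫ t in A, ‖w t‖ with hW
  have hsumF : ∀ y : E, ‖y‖ < ρ → ∀ t ∈ A,
      HasSum (fun n => p.changeOrigin (φ t) n fun _ => y) (F (z₀ + y + φ t)) := by
    intro y hy t ht
    have h1 : ‖φ t‖₊ < ρ := hφA t ht
    have h1' : (‖φ t‖₊ : ENNReal) < ρ := by exact_mod_cast h1
    have h2 : ‖y‖₊ < ρ := hy
    have h2' : (‖y‖₊ : ENNReal) < ρ := by exact_mod_cast h2
    have := (hp.changeOrigin (y := φ t) (h1'.trans (lt_of_le_of_lt le_self_add hρr))).hasSum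
      (y := y) (by
        rw [mem_eball_zero_iff, enorm_eq_nnnorm, lt_tsub_iff_right]
        exact (ENNReal.add_lt_add h2' h1').trans hρr)
    rwa [add_right_comm] at this
  have hnormle : ∀ y : E, ‖y‖ < ρ → ∀ n, ∀ t ∈ A,
      ‖w t * p.changeOrigin (φ t) n fun _ => y‖ ≤ ‖w t‖ * (b n * ρ ^ n) := by
    intro y hy n t ht
    rw [norm_mul]
    gcongr
    refine (ContinuousMultilinearMap.le_opNorm _ _).trans ?_
    simp only [Finset.prod_const, Finset.card_univ, Fintype.card_fin]
    have := hbound _ (hφA t ht) n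
    gcongr
  have hitg' : ∀ y : E, ∀ n, Integrable (fun t => w t * p.changeOrigin (φ t) n fun _ => y)
      (volume.restrict A) := by
    intro y n
    exact (ContinuousMultilinearMap.apply ℝ (fun _ : Fin n => E) ℝ (fun _ => y)).integrable_comp
      (hitg n)
  constructor
  · refine ⟨fun n => ∫ t in A, w t • p.changeOrigin (φ t) n, ρ, ?_, by exact_mod_cast hρ0, ?_⟩
    · refine FormalMultilinearSeries.le_radius_of_bound _ (W * ∑' k, (b k : ℝ) * (ρ:ℝ) ^ k) ?_
      intro n
      have h1 : ‖∫ t in A, w t • p.changeOrigin (φ t) n‖ ≤ W * b n := by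
        rw [hW, ← integral_mul_const]
        refine norm_integral_le_of_norm_le (hwn.mul_const _) ?_
        filter_upwards [hae n] with t ht
        rw [norm_smul]; gcongr
      have hW0 : 0 ≤ W := integral_nonneg fun _ => norm_nonneg _
      calc _ ≤ W * b n * ρ ^ n := by gcongr
        _ = W * (b n * ρ ^ n) := by ring
        _ ≤ _ := by
          gcongr
          exact hbs'.le_tsum n (fun _ _ => by positivity)
    · intro y hy
      have hy : ‖y‖ < ρ := by
        rw [mem_eball_zero_iff, enorm_eq_nnnorm] at hy
        exact_mod_cast hy
      have key := hasSum_integral_of_summable_integral_norm (hitg' y) (by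
        refine Summable.of_nonneg_of_le (fun n => integral_nonneg fun _ => norm_nonneg _)
          (fun n => ?_) (hbs'.mul_left W)
        rw [hW, ← integral_mul_const]
        refine setIntegral_mono_on (hitg' y n).norm (hwn.mul_const _) hA (hnormle y hy n))
      have e1 : (∫ t in A, ∑' n, w t * p.changeOrigin (φ t) n fun _ => y)
          = ∫ t in A, w t * F (z₀ + y + φ t) := by
        refine setIntegral_congr_fun hA fun t ht => ?_
        exact ((hsumF y hy t ht).mul_left (w t)).tsum_eq
      rw [e1] at key
      convert key using 2 with n
      rw [ContinuousMultilinearMap.integral_apply (hitg n)]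
      simp
  · have : Metric.ball z₀ (ρ:ℝ) ∈ nhds z₀ := Metric.ball_mem_nhds _ (by exact_mod_cast hρ0)
    filter_upwards [this] with z hz
    have hy : ‖z - z₀‖ < ρ := by simpa [dist_eq_norm] using hz
    have e : ∀ t ∈ A, HasSum (fun n => p.changeOrigin (φ t) n fun _ => z - z₀) (F (z + φ t)) := by
      intro t ht
      have := hsumF _ hy t ht
      rwa [add_sub_cancel] at this
    refine Integrable.mono' (g := fun t => ‖w t‖ * ∑' k, (b k : ℝ) * (ρ:ℝ) ^ k)
      (hwn.mul_const _) ?_ ?_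
    · refine hw.aestronglyMeasurable.mul ?_
      have : AEStronglyMeasurable (fun t => ∑' n, p.changeOrigin (φ t) n fun _ => z - z₀)
          (volume.restrict A) := by
        refine AEMeasurable.aestronglyMeasurable ?_
        refine aemeasurable_of_tendsto_metrizable_ae' (f := fun N t => ∑ n ∈ Finset.range N, p.changeOrigin (φ t) n fun _ => z - z₀) ?_ ?_
        · intro N
          refine Finset.aemeasurable_fun_sum _ fun n _ => ?_
          exact ((ContinuousMultilinearMap.apply ℝ (fun _ : Fin n => E) ℝ
            (fun _ => z - z₀)).continuous.comp_aestronglyMeasurable (hmeas n)).aemeasurable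
        · filter_upwards [ae_restrict_mem hA] with t ht
          have := (e t ht)
          rw [this.tsum_eq]
          exact this.tendsto_sum_nat
      refine this.congr ?_
      filter_upwards [ae_restrict_mem hA] with t ht
      exact (e t ht).tsum_eq
    · filter_upwards [ae_restrict_mem hA] with t ht
      have h1 := (e t ht).mul_left (w t)
      rw [← h1.tsum_eq, ← tsum_mul_left]
      have hs : Summable fun n => ‖w t * p.changeOrigin (φ t) n fun _ => z - z₀‖ :=
        Summable.of_nonneg_of_le (fun _ => norm_nonneg _) (fun n => hnormle _ hy n t ht)
          (hbs'.mul_left _)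
      exact (norm_tsum_le_tsum_norm hs).trans (hs.tsum_le_tsum (fun n => hnormle _ hy n t ht) (hbs'.mul_left _))

theorem aux_param_s14 (F : (ℝ × ℝ) × ℝ → ℝ) (w : ℝ → ℝ) (K : Set ℝ) (hK : IsCompact K)
    (hw : IntegrableOn w K) (κ₀ : ℝ × ℝ) (hF : ∀ t ∈ K, AnalyticAt ℝ F (κ₀, t)) :
    AnalyticAt ℝ (fun κ => ∫ t in K, w t * F (κ, t)) κ₀ ∧
      ∀ᶠ κ in nhds κ₀, IntegrableOn (fun t => w t * F (κ, t)) K := by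
  have main : ∃ s' : Set ℝ, K ⊆ s' ∧ MeasurableSet s' ∧ ∀ A ⊆ s', MeasurableSet A →
      IntegrableOn w A → (AnalyticAt ℝ (fun κ => ∫ t in A, w t * F (κ, t)) κ₀ ∧
      ∀ᶠ κ in nhds κ₀, IntegrableOn (fun t => w t * F (κ, t)) A) := by
    refine hK.induction_on (p := fun s => ∃ s' : Set ℝ, s ⊆ s' ∧ MeasurableSet s' ∧
      ∀ A ⊆ s', MeasurableSet A →
      IntegrableOn w A → (AnalyticAt ℝ (fun κ => ∫ t in A, w t * F (κ, t)) κ₀ ∧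
      ∀ᶠ κ in nhds κ₀, IntegrableOn (fun t => w t * F (κ, t)) A)) ?_ ?_ ?_ ?_
    · refine ⟨∅, subset_rfl, MeasurableSet.empty, fun A hA _ _ => ?_⟩
      rw [subset_empty_iff] at hA
      subst hA
      simp [analyticAt_const]
    · rintro s t hst ⟨s', h1, h2⟩
      exact ⟨s', hst.trans h1, h2⟩
    · rintro s t ⟨s', hs, hsm, hs'⟩ ⟨t', ht, htm, ht'⟩
      refine ⟨s' ∪ t', union_subset_union hs ht, hsm.union htm, fun A hA hAm hwA => ?_⟩
      obtain ⟨a1, i1⟩ := hs' (A ∩ s') inter_subset_right (hAm.inter hsm)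
        (hwA.mono_set inter_subset_left)
      obtain ⟨a2, i2⟩ := ht' (A \ s') (fun x hx => (hA hx.1).resolve_left hx.2) (hAm.diff hsm)
        (hwA.mono_set sdiff_subset)
      have hu : (A ∩ s') ∪ (A \ s') = A := inter_union_sdiff A s'
      have hd : Disjoint (A ∩ s') (A \ s') := disjoint_sdiff_inter.symm
      constructor
      · refine (a1.add a2).congr ?_
        filter_upwards [i1, i2] with κ h1 h2
        have := setIntegral_union hd (hAm.diff hsm) h1 h2
        rw [hu] at this
        exact this.symm
      · filter_upwards [i1, i2] with κ h1 h2
        have := h1.union h2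
        rwa [hu] at this
    · intro t ht
      obtain ⟨ε, hε, h⟩ := aux_local F (κ₀, t) (hF t ht)
      refine ⟨Metric.ball t ε, mem_nhdsWithin_of_mem_nhds (Metric.ball_mem_nhds _ hε),
        Metric.ball t ε, subset_rfl, measurableSet_ball, fun A hA hAm hwA => ?_⟩
      obtain ⟨a, i⟩ := h (fun u => (0, u - t)) A w (by fun_prop) hAm (fun u hu => by
        have := hA hu
        rw [Metric.mem_ball, dist_eq_norm] at this
        simpa [Prod.norm_def, hε] using this) hwA
      have e : ∀ κ : ℝ × ℝ, ∀ u : ℝ, ((κ, t) + (0, u - t) : (ℝ × ℝ) × ℝ) = (κ, u) := by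
        intro κ u; simp
      constructor
      · have := AnalyticAt.fun_comp (f := fun κ : ℝ × ℝ => (κ, t)) a
          (analyticAt_id.prod analyticAt_const)
        simpa only [e] using this
      · have c : Filter.Tendsto (fun κ : ℝ × ℝ => (κ, t)) (nhds κ₀) (nhds (κ₀, t)) := by
          exact Continuous.tendsto (by fun_prop) κ₀
        have := c.eventually i
        simpa only [e] using this
  obtain ⟨s', h1, h2, h3⟩ := main
  exact h3 K h1 hK.measurableSet hw

theorem aux_sqrt {x : ℝ} (hx : 0 < x) : AnalyticAt ℝ Real.sqrt x := by
  exact (Real.contDiffAt_sqrt (n := ⊤) hx.ne').analyticAt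

theorem aux_sqrt_comp {E : Type*} [NormedAddCommGroup E] [NormedSpace ℝ E] {f : E → ℝ} {z : E}
    (hf : AnalyticAt ℝ f z) (h : 0 < f z) : AnalyticAt ℝ (fun y => Real.sqrt (f y)) z :=
  AnalyticAt.fun_comp (aux_sqrt h) hf

theorem aux_end (L : ℝ × ℝ → ℝ) (κ₀ : ℝ × ℝ) (hL : AnalyticAt ℝ L κ₀) (a : ℝ) (ha : a < L κ₀)
    (h : (ℝ × ℝ) × ℝ → ℝ) (hh : ∀ x ∈ Icc a (L κ₀), AnalyticAt ℝ h (κ₀, x))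
    (hpos : ∀ x ∈ Icc a (L κ₀), 0 < h (κ₀, x)) (ρ : ℝ → ℝ)
    (hρ : ∀ x ∈ Icc a (L κ₀), AnalyticAt ℝ ρ x) :
    AnalyticAt ℝ (fun κ => ∫ x in Ioo a (L κ), Real.sqrt (h (κ, x) * (L κ - x)) * ρ x) κ₀ := by
  have key := (aux_param_s14 (fun q => (L q.1 - a) *
      (Real.sqrt (h (q.1, L q.1 - (L q.1 - a) * q.2) * (L q.1 - a)) *
        ρ (L q.1 - (L q.1 - a) * q.2))) Real.sqrt (Icc 0 1) isCompact_Icc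
      (Real.continuous_sqrt.continuousOn.integrableOn_compact isCompact_Icc) κ₀ ?_).1
  · refine key.congr ?_
    have hev : ∀ᶠ κ in nhds κ₀, a < L κ := hL.continuousAt.eventually (lt_mem_nhds ha)
    filter_upwards [hev] with κ hκ
    have e := intervalIntegral.mul_integral_comp_sub_mul (a := 0) (b := 1)
      (f := fun x => Real.sqrt (h (κ, x) * (L κ - x)) * ρ x) (L κ - a) (L κ)
    simp only [mul_one, sub_sub_cancel, mul_zero, sub_zero] at e
    rw [← integral_Ioc_eq_integral_Ioo, ← intervalIntegral.integral_of_le hκ.le, ← e,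
      integral_Icc_eq_integral_Ioc, ← intervalIntegral.integral_of_le zero_le_one,
      ← intervalIntegral.integral_const_mul]
    refine intervalIntegral.integral_congr fun t ht => ?_
    rw [uIcc_of_le zero_le_one] at ht
    rw [← mul_assoc (h _), Real.sqrt_mul' _ ht.1]
    ring
  · intro t ht
    have hL' : AnalyticAt ℝ (fun q : (ℝ × ℝ) × ℝ => L q.1) (κ₀, t) :=
      AnalyticAt.fun_comp (f := Prod.fst) (x := ((κ₀, t) : (ℝ × ℝ) × ℝ)) hL analyticAt_fst
    have hd : 0 < L κ₀ - a := sub_pos.2 ha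
    have hx : L κ₀ - (L κ₀ - a) * t ∈ Icc a (L κ₀) := by
      constructor <;> nlinarith [ht.1, ht.2]
    have hX : AnalyticAt ℝ (fun q : (ℝ × ℝ) × ℝ => L q.1 - (L q.1 - a) * q.2) (κ₀, t) :=
      hL'.sub ((hL'.sub analyticAt_const).mul analyticAt_snd)
    have hp : AnalyticAt ℝ (fun q : (ℝ × ℝ) × ℝ => (q.1, L q.1 - (L q.1 - a) * q.2)) (κ₀, t) :=
      analyticAt_fst.prod hX
    refine (hL'.sub analyticAt_const).mul ((aux_sqrt_comp ?_ ?_).mul ?_)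
    · refine AnalyticAt.mul ?_ (hL'.sub analyticAt_const)
      exact AnalyticAt.fun_comp (f := fun q : (ℝ × ℝ) × ℝ => (q.1, L q.1 - (L q.1 - a) * q.2))
        (x := ((κ₀, t) : (ℝ × ℝ) × ℝ)) (hh _ hx) hp
    · exact mul_pos (hpos _ hx) hd
    · exact AnalyticAt.fun_comp (f := fun q : (ℝ × ℝ) × ℝ => L q.1 - (L q.1 - a) * q.2)
        (x := ((κ₀, t) : (ℝ × ℝ) × ℝ)) (hρ _ hx) hX

theorem aux_int (ρ : ℝ → ℝ)
    (h : ∃ δ > 0, ∃ G : ℝ → ℝ, AnalyticOnNhd ℝ G (Ioo (-δ) δ) ∧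
      ∀ x ∈ Ioo (0 : ℝ) δ, ρ x = G (Real.sqrt x) / Real.sqrt x) (B : ℝ) (hB : 0 < B) :
    ∃ c > 0, c < B ∧ IntervalIntegrable ρ volume 0 c := by
  obtain ⟨δ, hδ, G, hG, hρ⟩ := h
  obtain ⟨c, hc0, hc⟩ : ∃ c : ℝ, 0 < c ∧ c < min B (min δ (δ ^ 2)) :=
    exists_between (by positivity)
  simp only [lt_min_iff] at hc
  obtain ⟨hcB, hcδ, hcδ2⟩ := hc
  refine ⟨c, hc0, hcB, ?_⟩
  have h1 : IntervalIntegrable (fun x : ℝ => x ^ (-(1/2) : ℝ)) volume 0 c :=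
    intervalIntegral.intervalIntegrable_rpow' (by norm_num)
  have h2 : ContinuousOn (fun x => G (Real.sqrt x)) (uIcc 0 c) := by
    refine hG.continuousOn.comp Real.continuous_sqrt.continuousOn ?_
    intro x hx
    rw [uIcc_of_le hc0.le] at hx
    refine ⟨by linarith [Real.sqrt_nonneg x], ?_⟩
    rw [Real.sqrt_lt' hδ]
    linarith [hx.2]
  refine (h1.continuousOn_mul h2).congr_ae ?_
  rw [uIoc_of_le hc0.le]
  filter_upwards [ae_restrict_mem measurableSet_Ioc] with x hx
  rw [hρ x ⟨hx.1, by linarith [hx.2]⟩, Real.rpow_neg hx.1.le, ← Real.sqrt_eq_rpow, div_eq_mul_inv]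

theorem aux_p1 (z : (ℝ × ℝ) × ℝ) : AnalyticAt ℝ (fun q : (ℝ × ℝ) × ℝ => q.1.1) z :=
  AnalyticAt.fun_comp (f := Prod.fst) (x := z) analyticAt_fst analyticAt_fst

theorem aux_p2 (z : (ℝ × ℝ) × ℝ) : AnalyticAt ℝ (fun q : (ℝ × ℝ) × ℝ => q.1.2) z :=
  AnalyticAt.fun_comp (f := Prod.fst) (x := z) analyticAt_snd analyticAt_fst



/-- the three generalized action integrals of a Liouville billiard
table of classical type (boundary case (A)) are real analytic in `(κ₁,κ₂)` on
`(ν₃,0) × (0,ν₁)`. -/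
theorem stmt_14 (ν₃ ν₁ ν₀ : ℝ) (hν₃ : ν₃ < 0) (hν₁ : 0 < ν₁) (hν₀ : ν₁ < ν₀)
    (ρ₁ ρ₂ ρ₃ : ℝ → ℝ)
    (hρ₁ : AnalyticOnNhd ℝ ρ₁ (Ioo ν₁ ν₀))
    (hρ₁left : ∃ δ > 0, ∃ G : ℝ → ℝ, AnalyticOnNhd ℝ G (Ioo (-δ) δ) ∧
      ∀ x ∈ Ioo ν₁ (ν₁ + δ), ρ₁ x = G (Real.sqrt (x - ν₁)) / Real.sqrt (x - ν₁))
    (hρ₁right : ∃ δ > 0, ∃ G : ℝ → ℝ, AnalyticOnNhd ℝ G (Ioo (-δ) δ) ∧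
      ∀ x ∈ Ioo (ν₀ - δ) ν₀, ρ₁ x = G (Real.sqrt (ν₀ - x)) / Real.sqrt (ν₀ - x))
    (hρ₂ : AnalyticOnNhd ℝ ρ₂ (Ioo 0 ν₁))
    (hρ₂left : ∃ δ > 0, ∃ G : ℝ → ℝ, AnalyticOnNhd ℝ G (Ioo (-δ) δ) ∧
      ∀ x ∈ Ioo (0 : ℝ) δ, ρ₂ x = G (Real.sqrt x) / Real.sqrt x)
    (hρ₃ : ∃ U : Set ℝ, IsOpen U ∧ Icc 0 (Real.sqrt (-ν₃)) ⊆ U ∧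
      ∃ G : ℝ → ℝ, AnalyticOnNhd ℝ G U ∧
        ∀ x ∈ Ioo ν₃ (0 : ℝ), ρ₃ x = G (Real.sqrt (-x)) / Real.sqrt (-x)) :
    AnalyticOnNhd ℝ
      (fun κ : ℝ × ℝ =>
        ∫ x in Ioo ν₁ ν₀, Real.sqrt ((x - κ.1) * (x - κ.2)) * ρ₁ x)
      (Ioo ν₃ 0 ×ˢ Ioo 0 ν₁) ∧
    AnalyticOnNhd ℝ
      (fun κ : ℝ × ℝ =>
        ∫ x in Ioo 0 κ.2, Real.sqrt ((x - κ.1) * (κ.2 - x)) * ρ₂ x)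
      (Ioo ν₃ 0 ×ˢ Ioo 0 ν₁) ∧
    AnalyticOnNhd ℝ
      (fun κ : ℝ × ℝ =>
        ∫ x in Ioo ν₃ κ.1, Real.sqrt ((κ.1 - x) * (κ.2 - x)) * ρ₃ x)
      (Ioo ν₃ 0 ×ˢ Ioo 0 ν₁) := by
  refine ⟨?_, ?_, ?_⟩
  · rintro κ₀ ⟨hκ1, hκ2⟩
    have hitg : IntervalIntegrable ρ₁ volume ν₁ ν₀ := by
      obtain ⟨c, hc0, hcB, hc⟩ := aux_int (fun x => ρ₁ (ν₁ + x)) (by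
        obtain ⟨δ, hδ, G, hG, h⟩ := hρ₁left
        refine ⟨δ, hδ, G, hG, fun x hx => ?_⟩
        have := h (ν₁ + x) ⟨by linarith [hx.1], by linarith [hx.2]⟩
        simpa using this) (ν₀ - ν₁) (by linarith)
      obtain ⟨d, hd0, hdB, hd⟩ := aux_int (fun x => ρ₁ (ν₀ - x)) (by
        obtain ⟨δ, hδ, G, hG, h⟩ := hρ₁right
        refine ⟨δ, hδ, G, hG, fun x hx => ?_⟩
        have := h (ν₀ - x) ⟨by linarith [hx.2], by linarith [hx.1]⟩
        simpa using this) (ν₀ - ν₁) (by linarith)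
      have i1 : IntervalIntegrable ρ₁ volume ν₁ (c + ν₁) := by
        have := hc.comp_sub_right ν₁
        simpa using this
      have i3 : IntervalIntegrable ρ₁ volume (ν₀ - d) ν₀ := by
        have := (hd.comp_sub_left ν₀).symm
        simpa using this
      have i2 : IntervalIntegrable ρ₁ volume (c + ν₁) (ν₀ - d) := by
        refine (hρ₁.continuousOn.mono ?_).intervalIntegrable
        exact ordConnected_Ioo.uIcc_subset ⟨by linarith, by linarith⟩ ⟨by linarith, by linarith⟩
      exact (i1.trans i2).trans i3
    rw [intervalIntegrable_iff_integrableOn_Icc_of_le hν₀.le] at hitg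
    have key := (aux_param_s14 (fun q => Real.sqrt ((q.2 - q.1.1) * (q.2 - q.1.2))) ρ₁ (Icc ν₁ ν₀)
      isCompact_Icc hitg κ₀ ?_).1
    · refine key.congr (Filter.Eventually.of_forall fun κ => ?_)
      simp only [integral_Icc_eq_integral_Ioo, mul_comm (ρ₁ _)]
    · intro t ht
      refine aux_sqrt_comp ((analyticAt_snd.sub (aux_p1 _)).mul (analyticAt_snd.sub (aux_p2 _))) ?_
      exact mul_pos (by linarith [ht.1, hκ1.2]) (by linarith [ht.1, hκ2.2])
  · rintro κ₀ ⟨hκ1, hκ2⟩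
    obtain ⟨a, ha0, haκ, hitg⟩ := aux_int ρ₂ hρ₂left κ₀.2 hκ2.1
    rw [intervalIntegrable_iff_integrableOn_Icc_of_le ha0.le] at hitg
    obtain ⟨k1, i1⟩ := aux_param_s14 (fun q => Real.sqrt ((q.2 - q.1.1) * (q.1.2 - q.2))) ρ₂ (Icc 0 a)
      isCompact_Icc hitg κ₀ (by
        intro t ht
        refine aux_sqrt_comp ((analyticAt_snd.sub (aux_p1 _)).mul ((aux_p2 _).sub analyticAt_snd)) ?_
        exact mul_pos (by linarith [ht.1, hκ1.2]) (by linarith [ht.2]))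
    have k2 := aux_end (fun κ => κ.2) κ₀ analyticAt_snd a haκ (fun q => q.2 - q.1.1)
      (fun x _ => analyticAt_snd.sub (aux_p1 _)) (fun x hx => by
        have := hx.1; have := hκ1.2; simp only; linarith) ρ₂
      (fun x hx => hρ₂ x ⟨by linarith [hx.1], by have := hx.2; have := hκ2.2; simp only at *; linarith⟩)
    refine (k1.add k2).congr ?_
    have hev : ∀ᶠ κ in nhds κ₀, κ.2 ∈ Ioo a ν₁ :=
      continuous_snd.continuousAt.eventually (Ioo_mem_nhds haκ hκ2.2)
    filter_upwards [i1, hev] with κ hi hκ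
    have hu : Ioc 0 a ∪ Ioo a κ.2 = Ioo 0 κ.2 := Ioc_union_Ioo_eq_Ioo ha0.le hκ.1
    have hd : Disjoint (Ioc 0 a) (Ioo a κ.2) := by
      rw [Set.disjoint_left]; rintro x hx hx'; exact absurd hx.2 (not_le.2 hx'.1)
    simp only [Pi.add_apply]
    rw [integral_Icc_eq_integral_Ioc, ← hu, setIntegral_union hd measurableSet_Ioo]
    · simp only [mul_comm (ρ₂ _)]
    · simp only [mul_comm (ρ₂ _)] at hi
      exact hi.mono_set Ioc_subset_Icc_self
    · refine IntegrableOn.mono_set (t := Icc a κ.2) ?_ Ioo_subset_Icc_self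
      refine ContinuousOn.integrableOn_compact isCompact_Icc ?_
      refine ContinuousOn.mul (by fun_prop) (hρ₂.continuousOn.mono ?_)
      exact fun x hx => ⟨by linarith [hx.1], by linarith [hx.2, hκ.2]⟩
  · rintro κ₀ ⟨hκ1, hκ2⟩
    obtain ⟨U, hU, hsub, G, hG, hρ⟩ := hρ₃
    have k := aux_end (fun κ => κ.1) κ₀ analyticAt_fst ν₃ hκ1.1 (fun q => q.1.2 - q.2)
      (fun x _ => (aux_p2 _).sub analyticAt_snd) (fun x hx => by
        have := hx.2; have := hκ1.2; have := hκ2.1; simp only at *; linarith)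
      (fun x => G (Real.sqrt (-x)) / Real.sqrt (-x)) (fun x hx => by
        have h1 := hx.1
        have h2 := hx.2
        have h3 := hκ1.2
        have hx0 : 0 < -x := by linarith
        have hs : AnalyticAt ℝ (fun x : ℝ => Real.sqrt (-x)) x :=
          aux_sqrt_comp analyticAt_id.neg hx0
        refine AnalyticAt.div ?_ hs (Real.sqrt_pos.2 hx0).ne'
        refine AnalyticAt.fun_comp (f := fun x : ℝ => Real.sqrt (-x)) (hG _ (hsub ⟨Real.sqrt_nonneg _, ?_⟩)) hs
        exact Real.sqrt_le_sqrt (by linarith))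
    refine k.congr ?_
    have hev : ∀ᶠ κ in nhds κ₀, κ.1 < 0 :=
      continuous_fst.continuousAt.eventually (gt_mem_nhds hκ1.2)
    filter_upwards [hev] with κ hκ
    refine setIntegral_congr_fun measurableSet_Ioo fun x hx => ?_
    rw [hρ x ⟨hx.1, hx.2.trans hκ⟩, mul_comm (κ.1 - x)]
end
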